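/- arXiv:1706.01418 — 2 statements merged into one kernel-verified Lean document; each statement's English description precedes it below -/
import Mathlib

section
/- There exists an optimistically universal self-adaptive learning rule: a single self-adaptive learning rule that is strongly universally consistent under every process 𝕏 that admits strong universal self-adaptive learning (i.e., under every 𝕏 ∈ SUAL). -/
open MeasureTheory Filter Topology

/-- A self-adaptive learning rule: an array of measurable functions
`f_{n,m} : X^m × Y^n × X → Y` for `m ≥ n ≥ 0`. -/
def IsSelfAdaptiveRule {X Y : Type*} [MeasurableSpace X] [MeasurableSpace Y]
    (f : ∀ n m : ℕ, (Fin m → X) → (Fin n → Y) → X → Y) : Prop :=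
  ∀ n m : ℕ, n ≤ m →
    Measurable fun p : (Fin m → X) × (Fin n → Y) × X => f n m p.1 p.2.1 p.2.2

/-- The long-run average loss `L̂_𝕏(f_{n,·}, f*; n)` of a self-adaptive learning rule
along the path `x` (0-indexed):
`limsup_{t→∞} (1/(t+1)) ∑_{m=n}^{n+t} ℓ(f_{n,m}(X_{1:m}, f*(X_{1:n}), X_{m+1}), f*(X_{m+1}))`. -/
noncomputable def adaLoss {X Y : Type*} [PseudoMetricSpace Y]
    (f : ∀ n m : ℕ, (Fin m → X) → (Fin n → Y) → X → Y)
    (fstar : X → Y) (n : ℕ) (x : ℕ → X) : ℝ :=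
  Filter.limsup
    (fun t : ℕ =>
      (∑ s ∈ Finset.range (t + 1),
          dist (f n (n + s) (fun i => x i.1) (fun i => fstar (x i.1)) (x (n + s)))
            (fstar (x (n + s)))) / ((t : ℝ) + 1))
    Filter.atTop

/-- Strong universal consistency of a self-adaptive learning rule under the process with
law `μ`. -/
def StronglyConsistentAda {X Y : Type*} [MeasurableSpace X] [MeasurableSpace Y]
    [PseudoMetricSpace Y] (μ : Measure (ℕ → X))
    (f : ∀ n m : ℕ, (Fin m → X) → (Fin n → Y) → X → Y) : Prop :=
  ∀ fstar : X → Y, Measurable fstar →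
    ∀ᵐ x ∂μ, Tendsto (fun n => adaLoss f fstar n x) atTop (𝓝 0)

/-- `SUAL`: the process with law `μ` admits strong universal self-adaptive learning. -/
def SUAL {X : Type*} (Y : Type*) [MeasurableSpace X] [MeasurableSpace Y] [PseudoMetricSpace Y]
    (μ : Measure (ℕ → X)) : Prop :=
  ∃ f : ∀ n m : ℕ, (Fin m → X) → (Fin n → Y) → X → Y,
    IsSelfAdaptiveRule f ∧ StronglyConsistentAda μ f


noncomputable section OptRule

variable {X Y : Type*} [MetricSpace Y]

def avgA (g : ℕ → X → Y) (s i j : ℕ) (u : ℕ → X) : ℝ :=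
  (∑ t ∈ Finset.range s, dist (g i (u t)) (g j (u t))) / s

def avgD (g : ℕ → X → Y) (s i : ℕ) (u : ℕ → X) (v : ℕ → Y) : ℝ :=
  (∑ t ∈ Finset.range s, dist (g i (u t)) (v t)) / s

def goodK (g : ℕ → X → Y) (n m : ℕ) (u : ℕ → X) (k : ℕ) : Prop :=
  ∀ i, i ≤ k → ∀ j, j ≤ k → ∀ s, n ≤ s → s ≤ m →
    ∃ s', k ≤ s' ∧ s' ≤ n ∧ avgA g s i j u ≤ avgA g s' i j u + 1 / ((k : ℝ) + 1)

def goodI (g : ℕ → X → Y) (n k : ℕ) (u : ℕ → X) (v : ℕ → Y) (i : ℕ) : Prop :=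
  ∀ j, j ≤ k → ∀ s, k ≤ s → s ≤ n →
    ∃ s', k ≤ s' ∧ s' ≤ n ∧ avgD g s i u v ≤ avgD g s' j u v

instance instDecGoodK (g : ℕ → X → Y) (n m : ℕ) (u : ℕ → X) : DecidablePred (goodK g n m u) :=
  Classical.decPred _

instance instDecGoodI (g : ℕ → X → Y) (n k : ℕ) (u : ℕ → X) (v : ℕ → Y) :
    DecidablePred (goodI g n k u v) := Classical.decPred _

def kSel (g : ℕ → X → Y) (n m : ℕ) (u : ℕ → X) : ℕ := Nat.findGreatest (goodK g n m u) n

def iSel (g : ℕ → X → Y) (n k : ℕ) (u : ℕ → X) (v : ℕ → Y) : ℕ :=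
  Nat.findGreatest (goodI g n k u v) k

def rule0 (g : ℕ → X → Y) (n m : ℕ) (u : ℕ → X) (v : ℕ → Y) (x : X) : Y :=
  g (iSel g n (kSel g n m u) u v) x

def extSeq {Z : Type*} (z0 : Z) {m : ℕ} (x : Fin m → Z) (i : ℕ) : Z :=
  if h : i < m then x ⟨i, h⟩ else z0

def ruleF (g : ℕ → X → Y) (x0 : X) (y0 : Y) (n m : ℕ) (x : Fin m → X) (y : Fin n → Y) (x' : X) :
    Y := rule0 g n m (extSeq x0 x) (extSeq y0 y) x'

lemma measurable_extSeq {Z : Type*} [MeasurableSpace Z] (z0 : Z) (m : ℕ) :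
    Measurable (fun x : Fin m → Z => extSeq z0 x) := by
  refine measurable_pi_iff.2 fun i => ?_
  unfold extSeq
  by_cases h : i < m
  · simp only [h, dif_pos]; exact measurable_pi_apply _
  · simp only [h, dif_neg, not_false_eq_true]; exact measurable_const

lemma measurable_avgA [MeasurableSpace X] [MeasurableSpace Y] [BorelSpace Y]
    [SecondCountableTopology Y] (g : ℕ → X → Y) (hg : ∀ i, Measurable (g i)) (s i j : ℕ) :
    Measurable (fun u : ℕ → X => avgA g s i j u) := by
  unfold avgA
  refine Measurable.div_const (Finset.measurable_sum _ fun t _ => ?_) _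
  exact ((hg i).comp (measurable_pi_apply t)).dist ((hg j).comp (measurable_pi_apply t))

lemma measurable_avgD [MeasurableSpace X] [MeasurableSpace Y] [BorelSpace Y]
    [SecondCountableTopology Y] (g : ℕ → X → Y) (hg : ∀ i, Measurable (g i)) (s i : ℕ) :
    Measurable (fun p : (ℕ → X) × (ℕ → Y) => avgD g s i p.1 p.2) := by
  unfold avgD
  refine Measurable.div_const (Finset.measurable_sum _ fun t _ => ?_) _
  exact ((hg i).comp ((measurable_pi_apply t).comp measurable_fst)).dist
    ((measurable_pi_apply t).comp measurable_snd)

lemma measurable_kSel [MeasurableSpace X] [MeasurableSpace Y] [BorelSpace Y]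
    [SecondCountableTopology Y] (g : ℕ → X → Y) (hg : ∀ i, Measurable (g i)) (n m : ℕ) :
    Measurable (fun u : ℕ → X => kSel g n m u) := by
  unfold kSel
  refine measurable_findGreatest (p := goodK g n m) fun k _ => ?_
  unfold goodK
  refine measurableSet_setOfPred.2 ?_
  refine Measurable.forall fun i => Measurable.imp measurable_const ?_
  refine Measurable.forall fun j => Measurable.imp measurable_const ?_
  refine Measurable.forall fun s => Measurable.imp measurable_const ?_
  refine Measurable.imp measurable_const ?_
  refine Measurable.exists fun s' => Measurable.and measurable_const ?_
  refine Measurable.and measurable_const ?_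
  exact measurableSet_setOfPred.1 (measurableSet_le (measurable_avgA g hg _ _ _)
    ((measurable_avgA g hg _ _ _).add_const _))

lemma measurable_iSel [MeasurableSpace X] [MeasurableSpace Y] [BorelSpace Y]
    [SecondCountableTopology Y] (g : ℕ → X → Y) (hg : ∀ i, Measurable (g i)) (n k : ℕ) :
    Measurable (fun p : (ℕ → X) × (ℕ → Y) => iSel g n k p.1 p.2) := by
  unfold iSel
  refine measurable_findGreatest (p := fun p : (ℕ → X) × (ℕ → Y) => goodI g n k p.1 p.2)
    fun i _ => ?_
  unfold goodI
  refine measurableSet_setOfPred.2 ?_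
  refine Measurable.forall fun j => Measurable.imp measurable_const ?_
  refine Measurable.forall fun s => Measurable.imp measurable_const ?_
  refine Measurable.imp measurable_const ?_
  refine Measurable.exists fun s' => Measurable.and measurable_const ?_
  refine Measurable.and measurable_const ?_
  exact measurableSet_setOfPred.1 (measurableSet_le (measurable_avgD g hg _ _)
    (measurable_avgD g hg _ _))

lemma measurable_rule0 [MeasurableSpace X] [MeasurableSpace Y] [BorelSpace Y]
    [SecondCountableTopology Y] (g : ℕ → X → Y) (hg : ∀ i, Measurable (g i)) (n m : ℕ) :
    Measurable (fun p : (ℕ → X) × (ℕ → Y) × X => rule0 g n m p.1 p.2.1 p.2.2) := by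
  have hi' : Measurable (fun q : ℕ × ((ℕ → X) × (ℕ → Y)) => iSel g n q.1 q.2.1 q.2.2) :=
    measurable_from_prod_countable_right (measurable_iSel g hg n)
  have hg' : Measurable (fun q : ℕ × X => g q.1 q.2) := measurable_from_prod_countable_right hg
  have hk : Measurable (fun p : (ℕ → X) × (ℕ → Y) × X => (kSel g n m p.1, (p.1, p.2.1))) :=
    Measurable.prodMk ((measurable_kSel g hg n m).comp measurable_fst)
      (Measurable.prodMk measurable_fst (measurable_fst.comp measurable_snd))
  have hj : Measurable (fun p : (ℕ → X) × (ℕ → Y) × X =>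
      (iSel g n (kSel g n m p.1) p.1 p.2.1, p.2.2)) :=
    Measurable.prodMk (hi'.comp hk) (measurable_snd.comp measurable_snd)
  exact hg'.comp hj

lemma measurable_ruleF [MeasurableSpace X] [MeasurableSpace Y] [BorelSpace Y]
    [SecondCountableTopology Y]
    (g : ℕ → X → Y) (hg : ∀ i, Measurable (g i)) (x0 : X) (y0 : Y) :
    IsSelfAdaptiveRule (ruleF g x0 y0) := by
  unfold IsSelfAdaptiveRule
  intro n m hnm
  clear hnm
  unfold ruleF
  have h : Measurable (fun p : (Fin m → X) × (Fin n → Y) × X =>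
      (extSeq x0 p.1, extSeq y0 p.2.1, p.2.2)) :=
    Measurable.prodMk ((measurable_extSeq x0 m).comp measurable_fst)
      (Measurable.prodMk ((measurable_extSeq y0 n).comp (measurable_fst.comp measurable_snd))
        (measurable_snd.comp measurable_snd))
  have h2 := (measurable_rule0 g hg n m).comp h
  exact h2

lemma avgA_congr (g : ℕ → X → Y) (s i j : ℕ) {u u' : ℕ → X} (h : ∀ t < s, u t = u' t) :
    avgA g s i j u = avgA g s i j u' := by
  unfold avgA
  rw [Finset.sum_congr rfl fun t ht => by rw [h t (Finset.mem_range.1 ht)]]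

lemma avgD_congr (g : ℕ → X → Y) (s i : ℕ) {u u' : ℕ → X} {v v' : ℕ → Y}
    (h : ∀ t < s, u t = u' t) (h' : ∀ t < s, v t = v' t) :
    avgD g s i u v = avgD g s i u' v' := by
  unfold avgD
  rw [Finset.sum_congr rfl fun t ht => by
    rw [h t (Finset.mem_range.1 ht), h' t (Finset.mem_range.1 ht)]]

lemma ruleF_eq (g : ℕ → X → Y) (x0 : X) (y0 : Y) (n m : ℕ) (hnm : n ≤ m) (u : ℕ → X) (v : ℕ → Y)
    (x' : X) :
    ruleF g x0 y0 n m (fun i => u i.1) (fun i => v i.1) x' = rule0 g n m u v x' := by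
  have hu : ∀ t < m, extSeq x0 (fun i : Fin m => u i.1) t = u t := fun t ht => by
    simp [extSeq, ht]
  have hv : ∀ t < n, extSeq y0 (fun i : Fin n => v i.1) t = v t := fun t ht => by
    simp [extSeq, ht]
  have hK : goodK g n m (extSeq x0 (fun i : Fin m => u i.1)) = goodK g n m u := by
    funext k
    unfold goodK
    refine propext (forall_congr' fun i => forall_congr' fun _ => forall_congr' fun j =>
      forall_congr' fun _ => forall_congr' fun s => forall_congr' fun _ => forall_congr' fun hs =>
      exists_congr fun s' => and_congr_right fun _ => and_congr_right fun hs' => ?_)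
    rw [avgA_congr g s i j (fun t ht => hu t (by omega)),
      avgA_congr g s' i j (fun t ht => hu t (by omega))]
  have hI : ∀ k, goodI g n k (extSeq x0 (fun i : Fin m => u i.1))
      (extSeq y0 (fun i : Fin n => v i.1)) = goodI g n k u v := by
    intro k
    funext i
    unfold goodI
    refine propext (forall_congr' fun j => forall_congr' fun _ =>
      forall_congr' fun s => forall_congr' fun _ => forall_congr' fun hs =>
      exists_congr fun s' => and_congr_right fun _ => and_congr_right fun hs' => ?_)
    rw [avgD_congr g s i (fun t ht => hu t (by omega)) (fun t ht => hv t (by omega)),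
      avgD_congr g s' j (fun t ht => hu t (by omega)) (fun t ht => hv t (by omega))]
  have e1 : kSel g n m (extSeq x0 (fun i : Fin m => u i.1)) = kSel g n m u := by
    unfold kSel; congr! 1
  have e2 : ∀ k, iSel g n k (extSeq x0 (fun i : Fin m => u i.1))
      (extSeq y0 (fun i : Fin n => v i.1)) = iSel g n k u v := by
    intro k; unfold iSel; congr! 1; exact hI k
  simp only [ruleF, rule0, e1, e2]

def goodInf (g : ℕ → X → Y) (n : ℕ) (u : ℕ → X) (k : ℕ) : Prop := ∀ m, goodK g n m u k

lemma goodK_anti (g : ℕ → X → Y) (n : ℕ) (u : ℕ → X) (k : ℕ) {m m' : ℕ} (h : m ≤ m')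
    (hk : goodK g n m' u k) : goodK g n m u k :=
  fun i hi j hj s h1 h2 => hk i hi j hj s h1 (h2.trans h)

open Classical in
lemma kSel_eventually (g : ℕ → X → Y) (n : ℕ) (u : ℕ → X) :
    ∃ m0, ∀ m, m0 ≤ m → kSel g n m u = Nat.findGreatest (goodInf g n u) n := by
  have h : ∀ k, ∃ m0, ∀ m, m0 ≤ m → (goodK g n m u k ↔ goodInf g n u k) := by
    intro k
    by_cases hk : goodInf g n u k
    · exact ⟨0, fun m _ => ⟨fun _ => hk, fun _ => hk m⟩⟩
    · have hk' := hk
      unfold goodInf at hk'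
      push Not at hk'
      obtain ⟨m0, h0⟩ := hk'
      exact ⟨m0, fun m hm => ⟨fun h => absurd (goodK_anti g n u k hm h) h0, fun h => absurd h hk⟩⟩
  choose M hM using h
  refine ⟨(Finset.range (n + 1)).sup M, fun m hm => ?_⟩
  unfold kSel
  have key : ∀ N ≤ n, Nat.findGreatest (goodK g n m u) N = Nat.findGreatest (goodInf g n u) N := by
    intro N
    induction N with
    | zero => intro _; simp
    | succ N ih =>
      intro hN
      have := hM (N + 1) m ((Finset.le_sup (f := M) (Finset.mem_range.2 (by omega))).trans hm)
      rw [Nat.findGreatest_succ, Nat.findGreatest_succ, ih (by omega)]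
      simp only [this]
  exact key n le_rfl

lemma goodInf_eventually (g : ℕ → X → Y) (C : ℝ) (hC : ∀ y₁ y₂ : Y, dist y₁ y₂ ≤ C)
    (u : ℕ → X) (k : ℕ) : ∃ N, ∀ n, N ≤ n → goodInf g n u k := by
  have hC0 : 0 ≤ C := by
    have := hC (g 0 (u 0)) (g 0 (u 0)); simpa using this
  have hb : ∀ s i j, avgA g s i j u ≤ C := by
    intro s i j
    unfold avgA
    refine div_le_of_le_mul₀ (Nat.cast_nonneg s) hC0 ?_
    refine (Finset.sum_le_card_nsmul _ _ C fun t _ => hC _ _).trans ?_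
    simp [mul_comm]
  have h : ∀ i j, ∃ s', k ≤ s' ∧ ∀ s, k ≤ s → avgA g s i j u ≤ avgA g s' i j u + 1 / ((k:ℝ) + 1) := by
    intro i j
    let S : Set ℝ := (fun s => avgA g s i j u) '' {s | k ≤ s}
    have hne : S.Nonempty := ⟨_, k, le_refl k, rfl⟩
    have hbd : BddAbove S := ⟨C, by rintro _ ⟨s, _, rfl⟩; exact hb s i j⟩
    obtain ⟨_, ⟨s', hs', rfl⟩, hlt⟩ := exists_lt_of_lt_csSup hne
      (sub_lt_self (sSup S) (show (0:ℝ) < 1 / ((k:ℝ) + 1) by positivity))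
    refine ⟨s', hs', fun s hs => ?_⟩
    have := le_csSup hbd (⟨s, hs, rfl⟩ : avgA g s i j u ∈ S)
    simp only at hlt
    linarith
  choose M hM1 hM2 using h
  refine ⟨max k ((Finset.range (k + 1)).sup fun i => (Finset.range (k + 1)).sup fun j => M i j),
    fun n hn m i hi j hj s hs _ => ?_⟩
  have hkn : k ≤ n := (le_max_left _ _).trans hn
  refine ⟨M i j, hM1 i j, ?_, hM2 i j s (by omega)⟩
  refine le_trans ?_ ((le_max_right _ _).trans hn)
  refine le_trans ?_ (Finset.le_sup (f := fun i => (Finset.range (k + 1)).sup fun j => M i j)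
    (Finset.mem_range.2 (Nat.lt_succ_of_le hi)))
  exact Finset.le_sup (f := fun j => M i j) (Finset.mem_range.2 (Nat.lt_succ_of_le hj))

lemma goodI_iSel (g : ℕ → X → Y) (n k : ℕ) (hkn : k ≤ n) (u : ℕ → X) (v : ℕ → Y) :
    goodI g n k u v (iSel g n k u v) := by
  classical
  have hne : (Finset.Icc k n).Nonempty := ⟨k, by simp [hkn]⟩
  obtain ⟨i, hi, hmin⟩ := Finset.exists_min_image (Finset.range (k + 1))
    (fun i => (Finset.Icc k n).sup' hne fun s => avgD g s i u v) ⟨0, by simp⟩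
  have hgood : goodI g n k u v i := by
    intro j hj s hs hsn
    obtain ⟨s', hs', he⟩ := Finset.exists_mem_eq_sup' hne (fun s => avgD g s j u v)
    rw [Finset.mem_Icc] at hs'
    refine ⟨s', hs'.1, hs'.2, ?_⟩
    rw [← he]
    exact (Finset.le_sup' (fun s => avgD g s i u v) (Finset.mem_Icc.2 ⟨hs, hsn⟩)).trans
      (hmin j (Finset.mem_range.2 (Nat.lt_succ_of_le hj)))
  exact Nat.findGreatest_spec (P := goodI g n k u v) (Nat.lt_succ_iff.1 (Finset.mem_range.1 hi)) hgood

lemma iSel_le (g : ℕ → X → Y) (n k : ℕ) (u : ℕ → X) (v : ℕ → Y) : iSel g n k u v ≤ k :=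
  Nat.findGreatest_le k

lemma avgA_le (g : ℕ → X → Y) (s i j : ℕ) (u : ℕ → X) (v : ℕ → Y) :
    avgA g s i j u ≤ avgD g s i u v + avgD g s j u v := by
  unfold avgA avgD
  rw [← add_div, ← Finset.sum_add_distrib]
  gcongr with t ht
  exact dist_triangle_right _ _ _

lemma avgD_le (g : ℕ → X → Y) (s i j : ℕ) (u : ℕ → X) (v : ℕ → Y) :
    avgD g s i u v ≤ avgA g s i j u + avgD g s j u v := by
  unfold avgA avgD
  rw [← add_div, ← Finset.sum_add_distrib]
  gcongr with t ht
  exact dist_triangle _ _ _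

lemma path_main (g : ℕ → X → Y) (C : ℝ) (hC : ∀ y₁ y₂ : Y, dist y₁ y₂ ≤ C) (x0 : X) (y0 : Y)
    (u : ℕ → X) (fs : X → Y) (ε : ℝ) (hε : 0 < ε) (i0 s0 : ℕ)
    (h : ∀ s, s0 ≤ s → avgD g s i0 u (fun t => fs (u t)) ≤ ε) :
    ∀ᶠ n in atTop, adaLoss (ruleF g x0 y0) fs n u ≤ 5 * ε := by
  classical
  set v : ℕ → Y := fun t => fs (u t) with hv
  have hC0 : 0 ≤ C := by
    have := hC y0 y0; simpa using this
  obtain ⟨k1, hk1⟩ := exists_nat_one_div_lt hε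
  set k := max (max s0 i0) k1 with hk
  obtain ⟨N, hN⟩ := goodInf_eventually g C hC u k
  filter_upwards [eventually_ge_atTop (max N k)] with n hn
  have hkn : k ≤ n := (le_max_right _ _).trans hn
  set κ := Nat.findGreatest (goodInf g n u) n with hκ
  have hkκ : k ≤ κ := Nat.le_findGreatest hkn (hN n ((le_max_left _ _).trans hn))
  have hκn : κ ≤ n := Nat.findGreatest_le n
  have hgood : goodInf g n u κ :=
    Nat.findGreatest_spec (P := goodInf g n u) hkn (hN n ((le_max_left _ _).trans hn))
  set ι := iSel g n κ u v with hι
  have hικ : ι ≤ κ := iSel_le g n κ u v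
  have hi0 : i0 ≤ κ := by omega
  have hs0 : s0 ≤ κ := by omega
  have hI := goodI_iSel g n κ hκn u v
  have h1κ : 1 / ((κ : ℝ) + 1) ≤ ε := by
    refine le_trans ?_ hk1.le
    have : (k1 : ℝ) ≤ κ := by exact_mod_cast (by omega : k1 ≤ κ)
    gcongr
  have hD1 : ∀ s, κ ≤ s → s ≤ n → avgD g s ι u v ≤ ε := by
    intro s h1 h2
    obtain ⟨s', h3, h4, h5⟩ := hI i0 hi0 s h1 h2
    exact h5.trans (h s' (by omega))
  have hD2 : ∀ s, n ≤ s → avgD g s ι u v ≤ 4 * ε := by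
    intro s hs
    obtain ⟨s', h3, h4, h5⟩ := hgood s ι hικ i0 hi0 s hs le_rfl
    have e1 := avgA_le g s' ι i0 u v
    have e2 := hD1 s' h3 h4
    have e3 := h s' (by omega)
    have e4 := avgD_le g s ι i0 u v
    have e5 := h s (by omega)
    linarith
  obtain ⟨m0, hm0⟩ := kSel_eventually g n u
  have hterm : ∀ s, dist (ruleF g x0 y0 n (n + s) (fun i => u i.1) (fun i => fs (u i.1)) (u (n + s)))
      (fs (u (n + s))) ≤ (if s < m0 then C else 0) + dist (g ι (u (n + s))) (v (n + s)) := by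
    intro s
    split_ifs with hs
    · exact (hC _ _).trans (le_add_of_nonneg_right dist_nonneg)
    · rw [ruleF_eq g x0 y0 n (n + s) (by omega) u v]
      unfold rule0
      rw [hm0 (n + s) (by omega), zero_add]
  have hsum : ∀ t : ℕ, (∑ s ∈ Finset.range (t + 1),
      dist (ruleF g x0 y0 n (n + s) (fun i => u i.1) (fun i => fs (u i.1)) (u (n + s)))
      (fs (u (n + s)))) ≤ m0 * C + 4 * ε * n + 4 * ε * (t + 1) := by
    intro t
    refine (Finset.sum_le_sum fun s _ => hterm s).trans ?_
    rw [Finset.sum_add_distrib]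
    have a1 : (∑ s ∈ Finset.range (t + 1), if s < m0 then C else 0) ≤ m0 * C := by
      rw [← Finset.sum_filter, Finset.sum_const, nsmul_eq_mul]
      gcongr
      calc _ ≤ (Finset.range m0).card := Finset.card_le_card (by
              intro s hs; simp at hs ⊢; exact hs.2)
        _ = m0 := Finset.card_range m0
    have a2 : (∑ s ∈ Finset.range (t + 1), dist (g ι (u (n + s))) (v (n + s)))
        ≤ 4 * ε * (n + (t + 1)) := by
      have b := hD2 (n + (t + 1)) (by omega)
      unfold avgD at b
      rw [div_le_iff₀ (by positivity), Finset.sum_range_add] at b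
      push_cast at b
      have : 0 ≤ ∑ s ∈ Finset.range n, dist (g ι (u s)) (v s) :=
        Finset.sum_nonneg fun _ _ => dist_nonneg
      linarith
    linarith
  unfold adaLoss
  refine limsup_le_of_le ?_ ?_
  · refine IsCoboundedUnder.of_frequently_ge (a := 0) (Frequently.of_forall fun t => ?_)
    positivity
  · have hlim : Tendsto (fun t : ℕ => ((t : ℝ) + 1)) atTop atTop :=
      tendsto_atTop_add_const_right _ _ tendsto_natCast_atTop_atTop
    filter_upwards [hlim.eventually_ge_atTop ((m0 * C + 4 * ε * n) / ε)] with t ht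
    rw [div_le_iff₀ hε] at ht
    rw [div_le_iff₀ (by positivity)]
    have := hsum t
    linarith

lemma adaLoss_nonneg (f : ∀ n m : ℕ, (Fin m → X) → (Fin n → Y) → X → Y)
    (C : ℝ) (hC : ∀ y₁ y₂ : Y, dist y₁ y₂ ≤ C) (fs : X → Y) (n : ℕ) (u : ℕ → X) :
    0 ≤ adaLoss f fs n u := by
  unfold adaLoss
  refine le_limsup_of_frequently_le (Frequently.of_forall fun t => by positivity) ?_
  refine ⟨C, eventually_map.2 (Eventually.of_forall fun t => ?_)⟩
  show _ / _ ≤ C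
  rw [div_le_iff₀ (by positivity)]
  refine (Finset.sum_le_card_nsmul _ _ C fun t _ => hC _ _).trans ?_
  simp [mul_comm]

end OptRule

noncomputable section OptApprox

open scoped ENNReal

variable {X Y : Type*}

def Mh (h : X → ℝ≥0∞) (u : ℕ → X) : ℝ≥0∞ :=
  limsup (fun t : ℕ => (∑ s ∈ Finset.range t, h (u s)) / (t : ℝ≥0∞)) atTop

lemma Mh_mono {h h' : X → ℝ≥0∞} (hh : ∀ x, h x ≤ h' x) (u : ℕ → X) : Mh h u ≤ Mh h' u := by
  unfold Mh
  refine limsup_le_limsup (Eventually.of_forall fun t => ?_)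
  exact ENNReal.div_le_div_right (Finset.sum_le_sum fun s _ => hh _) _

lemma ennreal_limsup_add_le (a b : ℕ → ℝ≥0∞) :
    limsup (fun t => a t + b t) atTop ≤ limsup a atTop + limsup b atTop := by
  refine ENNReal.le_of_forall_pos_le_add fun ε hε hlt => ?_
  have hε' : (ε : ℝ≥0∞) / 2 ≠ 0 := by simp [hε.ne']
  have ha : limsup a atTop < ⊤ := lt_of_le_of_lt le_self_add hlt
  have hb : limsup b atTop < ⊤ := lt_of_le_of_lt le_add_self hlt
  have h1 := eventually_lt_of_limsup_lt (ENNReal.lt_add_right ha.ne hε')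
  have h2 := eventually_lt_of_limsup_lt (ENNReal.lt_add_right hb.ne hε')
  refine limsup_le_of_le (h := ?_)
  filter_upwards [h1, h2] with t h1 h2
  refine (add_le_add h1.le h2.le).trans ?_
  rw [add_add_add_comm, ENNReal.add_halves]

lemma Mh_add (h h' : X → ℝ≥0∞) (u : ℕ → X) : Mh (fun x => h x + h' x) u ≤ Mh h u + Mh h' u := by
  unfold Mh
  simp only [Finset.sum_add_distrib, ENNReal.add_div]
  exact ennreal_limsup_add_le _ _

lemma Mh_mul (c : ℝ≥0∞) (hc : c ≠ ⊤) (h : X → ℝ≥0∞) (u : ℕ → X) :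
    Mh (fun x => c * h x) u = c * Mh h u := by
  unfold Mh
  simp only [← Finset.mul_sum, mul_div_assoc]
  exact ENNReal.limsup_const_mul_of_ne_top hc

lemma Mh_le_const (c : ℝ≥0∞) (h : X → ℝ≥0∞) (hh : ∀ x, h x ≤ c) (u : ℕ → X) : Mh h u ≤ c := by
  unfold Mh
  refine limsup_le_of_le (h := Eventually.of_forall fun t => ?_)
  refine ENNReal.div_le_of_le_mul ?_
  refine (Finset.sum_le_card_nsmul _ _ c fun t _ => hh _).trans ?_
  simp [mul_comm]

lemma measurable_Mh [MeasurableSpace X] {h : X → ℝ≥0∞} (hh : Measurable h) :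
    Measurable (Mh h) := by
  unfold Mh
  refine Measurable.limsup fun t => ?_
  refine Measurable.div_const (Finset.measurable_sum _ fun s _ => ?_) _
  exact hh.comp (measurable_pi_apply s)

open Classical in
def ind (A : Set X) (x : X) : ℝ≥0∞ := if x ∈ A then 1 else 0

lemma ind_le_one (A : Set X) (x : X) : ind A x ≤ 1 := by unfold ind; split_ifs <;> simp

lemma ind_mono {A B : Set X} (h : A ⊆ B) (x : X) : ind A x ≤ ind B x := by
  unfold ind
  by_cases hx : x ∈ A
  · simp [hx, h hx]
  · simp [hx]

lemma ind_union (A B : Set X) (x : X) : ind (A ∪ B) x ≤ ind A x + ind B x := by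
  unfold ind
  by_cases hA : x ∈ A <;> by_cases hB : x ∈ B <;> simp [hA, hB]

lemma measurable_ind [MeasurableSpace X] {A : Set X} (hA : MeasurableSet A) :
    Measurable (ind A) := by
  unfold ind
  exact Measurable.ite hA measurable_const measurable_const

variable [MeasurableSpace X]

def ns (μ : Measure (ℕ → X)) (A : Set X) : ℝ≥0∞ := ∫⁻ u, Mh (ind A) u ∂μ

lemma ns_mono (μ : Measure (ℕ → X)) {A B : Set X} (h : A ⊆ B) : ns μ A ≤ ns μ B :=
  lintegral_mono fun u => Mh_mono (ind_mono h) u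

lemma ns_union (μ : Measure (ℕ → X)) {A B : Set X} (hA : MeasurableSet A) :
    ns μ (A ∪ B) ≤ ns μ A + ns μ B := by
  unfold ns
  rw [← lintegral_add_left (measurable_Mh (measurable_ind hA))]
  exact lintegral_mono fun u => (Mh_mono (ind_union A B) u).trans (Mh_add _ _ u)

lemma ns_empty (μ : Measure (ℕ → X)) : ns μ ∅ = 0 := by
  have : ∀ u : ℕ → X, Mh (ind ∅) u = 0 := fun u =>
    le_antisymm (Mh_le_const 0 _ (fun x => by simp [ind]) u) bot_le
  simp [ns, this]

def C1 (μ : Measure (ℕ → X)) : Prop :=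
  ∀ A : ℕ → Set X, (∀ k, MeasurableSet (A k)) → Antitone A → (⋂ k, A k) = ∅ →
    Tendsto (fun k => ns μ (A k)) atTop (𝓝 0)

lemma C1.exists_le {μ : Measure (ℕ → X)} (h : C1 μ) {A : ℕ → Set X}
    (hA : ∀ k, MeasurableSet (A k)) (ha : Antitone A) (hi : (⋂ k, A k) = ∅) {ε : ℝ≥0∞}
    (hε : 0 < ε) : ∃ k, ns μ (A k) ≤ ε :=
  ((h A hA ha hi).eventually (ge_mem_nhds hε)).exists

structure GoodSeq (T : ℕ → Set X) : Prop where
  meas : ∀ a, MeasurableSet (T a)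
  empty : ∃ a, T a = ∅
  compl : ∀ a, ∃ b, T b = (T a)ᶜ
  union : ∀ a b, ∃ c, T c = T a ∪ T b
  gen : ∀ s : Set X, MeasurableSet s → MeasurableSet[MeasurableSpace.generateFrom (Set.range T)] s

lemma exists_goodSeq [TopologicalSpace X] [SecondCountableTopology X] [BorelSpace X] :
    ∃ T : ℕ → Set X, GoodSeq T := by
  obtain ⟨b, hbc, -, hb⟩ := TopologicalSpace.exists_countable_basis X
  have hgen : (inferInstance : MeasurableSpace X) = MeasurableSpace.generateFrom b :=
    (BorelSpace.measurable_eq).trans hb.borel_eq_generateFrom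
  have hgen2 : (inferInstance : MeasurableSpace X) =
      MeasurableSpace.generateFrom (generateSetAlgebra b) :=
    hgen.trans generateFrom_generateSetAlgebra_eq.symm
  have hc := countable_generateSetAlgebra hbc
  have halg := isSetAlgebra_generateSetAlgebra (𝒜 := b)
  obtain ⟨T, hT⟩ := hc.exists_eq_range ⟨∅, halg.empty_mem⟩
  have hmem : ∀ a, T a ∈ generateSetAlgebra b := fun a => by rw [hT]; exact ⟨a, rfl⟩
  refine ⟨T, ⟨fun a => ?_, ?_, fun a => ?_, fun a c => ?_, fun s hs => ?_⟩⟩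
  · have : MeasurableSet[MeasurableSpace.generateFrom (generateSetAlgebra b)] (T a) :=
      MeasurableSpace.measurableSet_generateFrom (hmem a)
    rw [← hgen2] at this
    exact this
  · have := halg.empty_mem; rw [hT] at this; exact this
  · have := halg.compl_mem (hmem a); rw [hT] at this; exact this
  · have := halg.union_mem (hmem a) (hmem c); rw [hT] at this; exact this
  · rw [← hT, ← hgen2]; exact hs

lemma approx_set {T : ℕ → Set X} (hT : GoodSeq T) {μ : Measure (ℕ → X)} (hμ : C1 μ)
    (A : Set X) (hA : MeasurableSet A) : ∀ ε : ℝ≥0∞, 0 < ε → ∃ a, ns μ (symmDiff A (T a)) ≤ ε := by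
  have hle : MeasurableSpace.generateFrom (Set.range T) ≤ (inferInstance : MeasurableSpace X) :=
    MeasurableSpace.generateFrom_le (by rintro _ ⟨a, rfl⟩; exact hT.meas a)
  induction A, hT.gen A hA using MeasurableSpace.generateFrom_induction with
  | hC t ht _ =>
    obtain ⟨a, rfl⟩ := ht
    intro ε hε
    exact ⟨a, by rw [symmDiff_self]; show ns μ ∅ ≤ ε; rw [ns_empty]; exact hε.le⟩
  | empty =>
    obtain ⟨a, ha⟩ := hT.empty
    intro ε hε
    exact ⟨a, by rw [ha, symmDiff_self]; show ns μ ∅ ≤ ε; rw [ns_empty]; exact hε.le⟩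
  | compl t ht ih =>
    intro ε hε
    obtain ⟨a, ha⟩ := ih (hle _ ht) ε hε
    obtain ⟨b, hb⟩ := hT.compl a
    refine ⟨b, ?_⟩
    rw [hb, compl_symmDiff_compl]
    exact ha
  | iUnion s hs ih =>
    intro ε hε
    have hsm : ∀ i, MeasurableSet (s i) := fun i => hle _ (hs i)
    have hfin : ∀ K, ∀ ε : ℝ≥0∞, 0 < ε → ∃ a, ns μ (symmDiff (⋃ i < K, s i) (T a)) ≤ ε := by
      intro K
      induction K with
      | zero =>
        intro ε hε
        obtain ⟨a, ha⟩ := hT.empty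
        exact ⟨a, by simp [ha, ns_empty]⟩
      | succ K ihK =>
        intro ε hε
        obtain ⟨a, ha⟩ := ihK (ε / 2) (ENNReal.half_pos hε.ne')
        obtain ⟨b, hb⟩ := ih K (hsm K) (ε / 2) (ENNReal.half_pos hε.ne')
        obtain ⟨c, hc⟩ := hT.union a b
        refine ⟨c, ?_⟩
        rw [← ENNReal.add_halves ε]
        refine le_trans (le_trans (ns_mono μ ?_) (ns_union μ (A := symmDiff (⋃ i < K, s i) (T a))
          (B := symmDiff (s K) (T b)) ?_)) (add_le_add ha hb)
        · rw [hc, Set.biUnion_lt_succ]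
          intro x hx
          simp only [Set.mem_symmDiff, Set.mem_union] at hx ⊢
          tauto
        · exact (MeasurableSet.iUnion fun i => MeasurableSet.iUnion fun _ => hsm i).symmDiff
            (hT.meas a)
    have hUm : ∀ K, MeasurableSet (⋃ i < K, s i) := fun K =>
      MeasurableSet.iUnion fun i => MeasurableSet.iUnion fun _ => hsm i
    obtain ⟨K, hK⟩ := hμ.exists_le (A := fun K => (⋃ i, s i) \ ⋃ i < K, s i)
      (fun K => (MeasurableSet.iUnion hsm).diff (hUm K))
      (by
        intro K K' h x hx
        refine ⟨hx.1, fun hx2 => hx.2 ?_⟩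
        simp only [Set.mem_iUnion] at hx2 ⊢
        obtain ⟨i, hi, hxi⟩ := hx2
        exact ⟨i, by omega, hxi⟩)
      (by
        ext x
        simp only [Set.mem_iInter, Set.mem_sdiff, Set.mem_iUnion, Set.mem_empty_iff_false, iff_false]
        intro h
        obtain ⟨i, hi⟩ := (h 0).1
        exact (h (i + 1)).2 ⟨i, by omega, hi⟩)
      (ENNReal.half_pos hε.ne')
    obtain ⟨a, ha⟩ := hfin K (ε / 2) (ENNReal.half_pos hε.ne')
    refine ⟨a, ?_⟩
    rw [← ENNReal.add_halves ε]
    refine le_trans (le_trans (ns_mono μ ?_) (ns_union μ (A := (⋃ i, s i) \ ⋃ i < K, s i)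
      (B := symmDiff (⋃ i < K, s i) (T a)) ?_)) (add_le_add hK ha)
    · intro x hx
      have hsub : x ∈ (⋃ i < K, s i) → x ∈ ⋃ i, s i := fun h => by
        simp only [Set.mem_iUnion] at h ⊢
        obtain ⟨i, _, h⟩ := h
        exact ⟨i, h⟩
      simp only [Set.mem_symmDiff, Set.mem_union, Set.mem_sdiff] at hx ⊢
      tauto
    · exact (MeasurableSet.iUnion hsm).diff (hUm K)

open Classical in
def dl (yd : ℕ → Y) : List (Set X × ℕ) → X → Y
  | [], _ => yd 0
  | p :: L, x => if x ∈ p.1 then yd p.2 else dl yd L x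

lemma measurable_dl [MeasurableSpace Y] (yd : ℕ → Y) (L : List (Set X × ℕ))
    (hL : ∀ p ∈ L, MeasurableSet p.1) : Measurable (dl yd L) := by
  induction L with
  | nil => exact measurable_const
  | cons p L ih =>
    exact Measurable.ite (hL p (by simp)) measurable_const
      (ih fun q hq => hL q (List.mem_cons_of_mem _ hq))

lemma dl_close [MetricSpace Y] (yd : ℕ → Y) (fs : X → Y) (ε : ℝ≥0∞) (L : List (Set X × ℕ))
    (h : ∀ p ∈ L, ∀ x ∈ p.1, edist (yd p.2) (fs x) ≤ ε) (x : X) (hx : ∃ p ∈ L, x ∈ p.1) :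
    edist (dl yd L x) (fs x) ≤ ε := by
  induction L with
  | nil => simp at hx
  | cons p L ih =>
    unfold dl
    split_ifs with hp
    · exact h p (by simp) x hp
    · refine ih (fun q hq => h q (List.mem_cons_of_mem _ hq)) ?_
      obtain ⟨q, hq, hxq⟩ := hx
      rcases List.mem_cons.1 hq with rfl | hq
      · exact absurd hxq hp
      · exact ⟨q, hq, hxq⟩

def listT (T : ℕ → Set X) (L : List (ℕ × ℕ)) : List (Set X × ℕ) := L.map fun p => (T p.1, p.2)

lemma measurable_dlT [MeasurableSpace Y] {T : ℕ → Set X} (hT : GoodSeq T) (yd : ℕ → Y)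
    (L : List (ℕ × ℕ)) : Measurable (dl yd (listT T L)) := by
  refine measurable_dl yd _ fun p hp => ?_
  obtain ⟨q, _, rfl⟩ := List.mem_map.1 hp
  exact hT.meas _

lemma approx_dl {T : ℕ → Set X} (hT : GoodSeq T) {μ : Measure (ℕ → X)} (hμ : C1 μ) (yd : ℕ → Y)
    (L : List (Set X × ℕ)) (hL : ∀ p ∈ L, MeasurableSet p.1) :
    ∀ ε : ℝ≥0∞, 0 < ε → ∃ L' : List (ℕ × ℕ), ∃ W : Set X, MeasurableSet W ∧ ns μ W ≤ ε ∧
      ∀ x, x ∉ W → dl yd L x = dl yd (listT T L') x := by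
  induction L with
  | nil => intro ε _; exact ⟨[], ∅, MeasurableSet.empty, by simp [ns_empty], fun x _ => rfl⟩
  | cons p L ih =>
    intro ε hε
    obtain ⟨L', W, hW, hWε, hx⟩ := ih (fun q hq => hL q (List.mem_cons_of_mem _ hq)) (ε / 2)
      (ENNReal.half_pos hε.ne')
    have hp := hL p (by simp)
    obtain ⟨a, ha⟩ := approx_set hT hμ p.1 hp (ε / 2) (ENNReal.half_pos hε.ne')
    refine ⟨(a, p.2) :: L', symmDiff p.1 (T a) ∪ W, (hp.symmDiff (hT.meas a)).union hW, ?_, ?_⟩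
    · rw [← ENNReal.add_halves ε]
      exact (ns_union μ (hp.symmDiff (hT.meas a))).trans (add_le_add ha hWε)
    · intro x hxn
      simp only [Set.mem_union, Set.mem_symmDiff, not_or, not_and, not_not] at hxn
      have := hx x hxn.2
      simp only [listT, List.map_cons, dl] at this ⊢
      by_cases h1 : x ∈ p.1
      · simp [h1, hxn.1.1 h1]
      · have h2 : x ∉ T a := fun h => h1 (hxn.1.2 h)
        simp [h1, h2, this]

lemma approx_fun [MetricSpace Y] [MeasurableSpace Y] [BorelSpace Y] {T : ℕ → Set X}
    (hT : GoodSeq T) {μ : Measure (ℕ → X)} [IsProbabilityMeasure μ]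
    (hμ : C1 μ) (yd : ℕ → Y) (hyd : DenseRange yd) (C : ℝ≥0∞) (hCt : C ≠ ⊤)
    (hC : ∀ y₁ y₂ : Y, edist y₁ y₂ ≤ C) (fs : X → Y) (hfs : Measurable fs) (ε : ℝ≥0∞) (hε : 0 < ε) :
    ∃ L : List (ℕ × ℕ),
      ∫⁻ u, Mh (fun x => edist (dl yd (listT T L) x) (fs x)) u ∂μ ≤ ε + (ε + ε) := by
  obtain ⟨δ, hδ, hδC⟩ := ENNReal.exists_nnreal_pos_mul_lt hCt hε.ne'
  have hδ' : (0 : ℝ≥0∞) < δ := by exact_mod_cast hδ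
  let S : ℕ → Set X := fun b => fs ⁻¹' (Metric.eball (yd b) ε)
  have hS : ∀ b, MeasurableSet (S b) := fun b => hfs Metric.isOpen_eball.measurableSet
  have hcov : ∀ x, ∃ b, x ∈ S b := by
    intro x
    obtain ⟨b, hb⟩ := hyd.exists_mem_open (Metric.isOpen_eball (x := fs x) (ε := ε))
      ⟨fs x, Metric.mem_eball_self hε⟩
    exact ⟨b, by simpa [S, Metric.mem_eball, edist_comm] using hb⟩
  have hUm : ∀ K, MeasurableSet (⋃ i < K, S i) := fun K =>
    MeasurableSet.iUnion fun i => MeasurableSet.iUnion fun _ => hS i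
  obtain ⟨K, hK⟩ := hμ.exists_le (A := fun K => (⋃ i < K, S i)ᶜ)
    (fun K => (hUm K).compl)
    (by
      intro K K' h x hx hx2
      refine hx ?_
      simp only [Set.mem_iUnion] at hx2 ⊢
      obtain ⟨i, hi, hxi⟩ := hx2
      exact ⟨i, by omega, hxi⟩)
    (by
      ext x
      simp only [Set.mem_iInter, Set.mem_compl_iff, Set.mem_iUnion, Set.mem_empty_iff_false,
        iff_false]
      intro h
      obtain ⟨i, hi⟩ := hcov x
      exact h (i + 1) ⟨i, by omega, hi⟩)
    hδ'
  let L : List (Set X × ℕ) := (List.range K).map fun b => (S b, b)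
  obtain ⟨L', W, hW, hWδ, hx⟩ := approx_dl hT hμ yd L (by
    intro p hp
    obtain ⟨b, _, rfl⟩ := List.mem_map.1 hp
    exact hS b) δ hδ'
  refine ⟨L', ?_⟩
  let V : Set X := (⋃ i < K, S i)ᶜ ∪ W
  have hV : ns μ V ≤ δ + δ := (ns_union μ (hUm K).compl).trans (add_le_add hK hWδ)
  have hpt : ∀ x, edist (dl yd (listT T L') x) (fs x) ≤ ε + C * ind V x := by
    intro x
    by_cases hxV : x ∈ V
    · refine (hC _ _).trans ?_
      simp [ind, hxV]
    · simp only [V, Set.mem_union, not_or, Set.mem_compl_iff, not_not] at hxV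
      rw [← hx x hxV.2]
      refine le_trans (dl_close yd fs ε L ?_ x ?_) le_self_add
      · intro p hp z hz
        obtain ⟨b, _, rfl⟩ := List.mem_map.1 hp
        have : edist (fs z) (yd b) < ε := hz
        rw [edist_comm]; exact this.le
      · have := hxV.1
        simp only [Set.mem_iUnion] at this
        obtain ⟨i, hi, hxi⟩ := this
        exact ⟨(S i, i), List.mem_map.2 ⟨i, List.mem_range.2 hi, rfl⟩, hxi⟩
  have hVm : MeasurableSet V := (hUm K).compl.union hW
  calc _ ≤ ∫⁻ u, (ε + C * Mh (ind V) u) ∂μ := by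
        refine lintegral_mono fun u => ?_
        refine (Mh_mono hpt u).trans ((Mh_add _ _ u).trans ?_)
        rw [Mh_mul C hCt]
        gcongr
        exact Mh_le_const ε _ (fun _ => le_rfl) u
    _ = ε + C * ns μ V := by
        rw [lintegral_add_left measurable_const, lintegral_const_mul _
          (measurable_Mh (measurable_ind hVm))]
        simp [ns]
    _ ≤ ε + (ε + ε) := by
        gcongr
        refine (mul_le_mul_right hV C).trans ?_
        rw [mul_add, mul_comm]
        exact add_le_add hδC.le hδC.le

end OptApprox

noncomputable section OptNecessity

open scoped ENNReal

variable {X Y : Type*} [MeasurableSpace X]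

def coin : Measure Bool := (PMF.uniformOfFintype Bool).toMeasure

instance : IsProbabilityMeasure coin := by unfold coin; infer_instance

lemma coin_flip : coin.map not = coin := by
  refine Measure.ext_of_singleton fun b => ?_
  rw [Measure.map_apply (measurable_of_finite _) (measurableSet_singleton b)]
  have : (not ⁻¹' {b}) = {!b} := by ext c; cases b <;> cases c <;> simp
  rw [this]
  unfold coin
  rw [PMF.toMeasure_apply_singleton _ _ (measurableSet_singleton _),
    PMF.toMeasure_apply_singleton _ _ (measurableSet_singleton _)]
  simp

def coins : Measure (ℕ → Bool) := Measure.infinitePi fun _ => coin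

instance : IsProbabilityMeasure coins := by unfold coins; infer_instance

def flipAt (j : ℕ) (b : ℕ → Bool) (i : ℕ) : Bool := if i = j then !(b i) else b i

lemma coins_flip (j : ℕ) : MeasurePreserving (flipAt j) coins coins := by
  have hm : ∀ i : ℕ, Measurable (fun c : Bool => if i = j then !c else c) := fun i =>
    measurable_of_finite _
  refine ⟨?_, ?_⟩
  · refine measurable_pi_iff.2 fun i => (hm i).comp (measurable_pi_apply i)
  · have h := Measure.infinitePi_map_pi (fun _ : ℕ => coin) hm
    have h2 : (fun i : ℕ => coin.map (fun c : Bool => if i = j then !c else c)) = fun _ => coin := by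
      funext i
      by_cases hij : i = j
      · simp only [hij, if_true]; exact coin_flip
      · simp only [hij, if_false]; exact Measure.map_id
    unfold coins
    simp only [h2] at h
    exact h

open Classical in
def idxA (A : ℕ → Set X) (hA : ∀ x, ∃ k, x ∉ A k) (x : X) : ℕ := Nat.find (hA x)

lemma idxA_spec (A : ℕ → Set X) (hA : ∀ x, ∃ k, x ∉ A k) (x : X) : x ∉ A (idxA A hA x) := by
  classical
  exact Nat.find_spec (hA x)

lemma idxA_min (A : ℕ → Set X) (hA : ∀ x, ∃ k, x ∉ A k) (x : X) {k : ℕ} (h : x ∉ A k) :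
    idxA A hA x ≤ k := by
  classical
  exact Nat.find_min' (hA x) h

lemma measurable_idxA {A : ℕ → Set X} (hAm : ∀ k, MeasurableSet (A k))
    (hA : ∀ x, ∃ k, x ∉ A k) : Measurable (idxA A hA) := by
  classical
  have := measurable_find (p := fun x k => x ∉ A k) hA fun k => (hAm k).compl
  unfold idxA
  convert this

def labF (A : ℕ → Set X) (hA : ∀ x, ∃ k, x ∉ A k) (y : Bool → Y) (b : ℕ → Bool) (x : X) : Y :=
  y (b (idxA A hA x))

variable [MetricSpace Y]

/-- extended-valued averaged loss at horizon `t` -/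
def lossE (f : ∀ n m : ℕ, (Fin m → X) → (Fin n → Y) → X → Y) (fs : X → Y) (n t : ℕ) (u : ℕ → X) :
    ℝ≥0∞ :=
  (∑ s ∈ Finset.range (t + 1),
    edist (f n (n + s) (fun i => u i.1) (fun i => fs (u i.1)) (u (n + s))) (fs (u (n + s))))
      / ((t : ℝ≥0∞) + 1)

lemma lossE_le (f : ∀ n m : ℕ, (Fin m → X) → (Fin n → Y) → X → Y) (fs : X → Y) (n t : ℕ)
    (u : ℕ → X) (C : ℝ≥0∞) (hC : ∀ y₁ y₂ : Y, edist y₁ y₂ ≤ C) : lossE f fs n t u ≤ C := by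
  refine ENNReal.div_le_of_le_mul ?_
  refine (Finset.sum_le_card_nsmul _ _ C fun t _ => hC _ _).trans ?_
  simp [mul_comm]

lemma limsup_lossE_le (f : ∀ n m : ℕ, (Fin m → X) → (Fin n → Y) → X → Y)
    (C : ℝ) (hC : ∀ y₁ y₂ : Y, dist y₁ y₂ ≤ C) (fs : X → Y) (n : ℕ) (u : ℕ → X) :
    limsup (fun t => lossE f fs n t u) atTop ≤ ENNReal.ofReal (adaLoss f fs n u) := by
  have he : ∀ t, lossE f fs n t u = ENNReal.ofReal ((∑ s ∈ Finset.range (t + 1),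
          dist (f n (n + s) (fun i => u i.1) (fun i => fs (u i.1)) (u (n + s)))
            (fs (u (n + s)))) / ((t : ℝ) + 1)) := by
    intro t
    rw [ENNReal.ofReal_div_of_pos (by positivity),
      ENNReal.ofReal_sum_of_nonneg (fun _ _ => dist_nonneg)]
    unfold lossE
    simp only [edist_dist]
    congr 1
    rw [ENNReal.ofReal_add (by positivity) (by positivity)]
    simp
  simp only [he]
  refine le_of_forall_gt_imp_ge_of_dense fun r hr => ?_
  by_cases hrt : r = ⊤
  · simp [hrt]
  have hr' : adaLoss f fs n u < r.toReal := (ENNReal.ofReal_lt_iff_lt_toReal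
    (adaLoss_nonneg f C hC fs n u) hrt).1 hr
  unfold adaLoss at hr'
  refine limsup_le_of_le (h := ?_)
  have hev := eventually_lt_of_limsup_lt hr' ⟨C, eventually_map.2 (Eventually.of_forall fun t => by
    show _ / _ ≤ C
    rw [div_le_iff₀ (by positivity)]
    refine (Finset.sum_le_card_nsmul _ _ C fun t _ => hC _ _).trans ?_
    simp [mul_comm])⟩
  filter_upwards [hev] with t ht
  exact ENNReal.ofReal_le_of_le_toReal ht.le

variable [MeasurableSpace Y] [BorelSpace Y]

lemma measurable_labF {A : ℕ → Set X} (hAm : ∀ k, MeasurableSet (A k)) (hA : ∀ x, ∃ k, x ∉ A k)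
    (y : Bool → Y) : Measurable (fun p : (ℕ → Bool) × X => labF A hA y p.1 p.2) := by
  classical
  have hidx := measurable_idxA hAm hA
  have hev : Measurable (fun q : (ℕ → Bool) × ℕ => q.1 q.2) :=
    measurable_from_prod_countable_left fun n => measurable_pi_apply n
  have h2 : Measurable (fun p : (ℕ → Bool) × X => (p.1, idxA A hA p.2)) :=
    Measurable.prodMk measurable_fst (hidx.comp measurable_snd)
  have hy : Measurable y := measurable_of_finite y
  have h3 := hy.comp (hev.comp h2)
  exact h3

lemma measurable_lossE [SecondCountableTopology Y]
    {f : ∀ n m : ℕ, (Fin m → X) → (Fin n → Y) → X → Y} (hf : IsSelfAdaptiveRule f)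
    {A : ℕ → Set X} (hAm : ∀ k, MeasurableSet (A k)) (hA : ∀ x, ∃ k, x ∉ A k)
    (y : Bool → Y) (n t : ℕ) :
    Measurable (fun p : (ℕ → Bool) × (ℕ → X) => lossE f (labF A hA y p.1) n t p.2) := by
  have hl := measurable_labF hAm hA y
  have hlab : ∀ i : ℕ, Measurable (fun p : (ℕ → Bool) × (ℕ → X) => labF A hA y p.1 (p.2 i)) := by
    intro i
    have h1 : Measurable (fun p : (ℕ → Bool) × (ℕ → X) => (p.1, p.2 i)) :=
      Measurable.prodMk measurable_fst ((measurable_pi_apply i).comp measurable_snd)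
    exact hl.comp h1
  unfold lossE
  refine Measurable.div_const (Finset.measurable_sum _ fun s _ => ?_) _
  refine Measurable.edist ?_ (hlab _)
  have h1 : Measurable (fun p : (ℕ → Bool) × (ℕ → X) =>
      ((fun i : Fin (n + s) => p.2 i.1), ((fun i : Fin n => labF A hA y p.1 (p.2 i.1)),
        p.2 (n + s)))) := by
    refine Measurable.prodMk ?_ (Measurable.prodMk ?_ ?_)
    · exact measurable_pi_iff.2 fun i => (measurable_pi_apply _).comp measurable_snd
    · exact measurable_pi_iff.2 fun i => hlab _
    · exact (measurable_pi_apply _).comp measurable_snd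
  have h2 := (hf n (n + s) (by omega)).comp h1
  exact h2

lemma term_lower [SecondCountableTopology Y]
    {f : ∀ n m : ℕ, (Fin m → X) → (Fin n → Y) → X → Y} 
    {A : ℕ → Set X} (hA : ∀ x, ∃ k, x ∉ A k)
    (hanti : Antitone A)
    (y : Bool → Y) (n s K : ℕ) (u : ℕ → X) (hK : ∀ i < n, u i ∉ A K)
    (hm : Measurable fun b => edist (f n (n + s) (fun i => u i.1)
      (fun i => labF A hA y b (u i.1)) (u (n + s))) (labF A hA y b (u (n + s)))) :
    edist (y false) (y true) / 2 * ind (A K) (u (n + s)) ≤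
      ∫⁻ b, edist (f n (n + s) (fun i => u i.1) (fun i => labF A hA y b (u i.1)) (u (n + s)))
        (labF A hA y b (u (n + s))) ∂coins := by
  classical
  by_cases hx : u (n + s) ∈ A K
  swap
  · simp [ind, hx]
  simp only [ind, hx, if_true, mul_one]
  set φ : (ℕ → Bool) → ℝ≥0∞ := fun b => edist (f n (n + s) (fun i => u i.1)
      (fun i => labF A hA y b (u i.1)) (u (n + s))) (labF A hA y b (u (n + s))) with hφ
  set j := idxA A hA (u (n + s)) with hj
  have hjK : K < j := by
    by_contra hcon
    exact idxA_spec A hA (u (n + s)) (hanti (not_lt.1 hcon) hx)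
  have hlab : ∀ b, ∀ i < n, labF A hA y (flipAt j b) (u i) = labF A hA y b (u i) := by
    intro b i hi
    have h1 : idxA A hA (u i) ≤ K := idxA_min A hA _ (hK i hi)
    unfold labF flipAt
    rw [if_neg (by omega)]
  have hlab2 : ∀ b, labF A hA y (flipAt j b) (u (n + s)) = y (!(b j)) := by
    intro b
    unfold labF flipAt
    rw [if_pos hj.symm]
  have hlab3 : ∀ b, labF A hA y b (u (n + s)) = y (b j) := fun b => rfl
  have hsum : ∀ b, edist (y false) (y true) ≤ φ b + φ (flipAt j b) := by
    intro b
    simp only [hφ]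
    rw [hlab2 b, hlab3 b]
    have e : (fun i : Fin n => labF A hA y (flipAt j b) (u i.1)) =
        fun i : Fin n => labF A hA y b (u i.1) := funext fun i => hlab b i.1 i.2
    rw [e]
    generalize f n (n + s) _ _ _ = p
    cases b j
    · exact edist_triangle_left _ _ _
    · rw [edist_comm (y false) (y true)]; exact edist_triangle_left _ _ _
  have hint : edist (y false) (y true) ≤ ∫⁻ b, φ b ∂coins + ∫⁻ b, φ b ∂coins := by
    calc edist (y false) (y true) = ∫⁻ _b, edist (y false) (y true) ∂coins := by simp
      _ ≤ ∫⁻ b, (φ b + φ (flipAt j b)) ∂coins := lintegral_mono hsum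
      _ = _ := by
        rw [lintegral_add_left hm, (coins_flip j).lintegral_comp hm]
  refine ENNReal.div_le_of_le_mul ?_
  rw [mul_two]
  exact hint

lemma limsup_shift (h : X → ℝ≥0∞) (h1 : ∀ x, h x ≤ 1) (n : ℕ) (u : ℕ → X) :
    Mh h u ≤ limsup (fun t : ℕ => (∑ s ∈ Finset.range (t + 1), h (u (n + s))) / ((t : ℝ≥0∞) + 1))
      atTop := by
  unfold Mh
  rw [← limsup_nat_add _ (n + 1)]
  have hle : ∀ t : ℕ, (∑ s ∈ Finset.range (t + (n + 1)), h (u s)) / ((t + (n + 1) : ℕ) : ℝ≥0∞)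
      ≤ (n : ℝ≥0∞) / (t : ℝ≥0∞) +
        (∑ s ∈ Finset.range (t + 1), h (u (n + s))) / ((t : ℝ≥0∞) + 1) := by
    intro t
    have e : t + (n + 1) = n + (t + 1) := by omega
    rw [e, Finset.sum_range_add, ENNReal.add_div]
    refine add_le_add (ENNReal.div_le_div ?_ ?_) (ENNReal.div_le_div le_rfl ?_)
    · refine (Finset.sum_le_card_nsmul _ _ 1 fun t _ => h1 _).trans ?_
      simp
    · exact_mod_cast (by omega : t ≤ n + (t + 1))
    · exact_mod_cast (by omega : t + 1 ≤ n + (t + 1))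
  refine (limsup_le_limsup (Eventually.of_forall hle)).trans ?_
  refine (ennreal_limsup_add_le _ _).trans ?_
  have : Tendsto (fun t : ℕ => (n : ℝ≥0∞) / (t : ℝ≥0∞)) atTop (𝓝 0) := by
    have := ENNReal.Tendsto.const_mul (a := (n : ℝ≥0∞)) ENNReal.tendsto_inv_nat_nhds_zero
      (Or.inr (ENNReal.natCast_ne_top n))
    simpa [div_eq_mul_inv] using this
  rw [this.limsup_eq, zero_add]

lemma path_lower [SecondCountableTopology Y]
    {f : ∀ n m : ℕ, (Fin m → X) → (Fin n → Y) → X → Y} (hf : IsSelfAdaptiveRule f)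
    {A : ℕ → Set X} (hAm : ∀ k, MeasurableSet (A k)) (hA : ∀ x, ∃ k, x ∉ A k)
    (hanti : Antitone A) (C : ℝ≥0∞) (hCt : C ≠ ⊤) (hC : ∀ y₁ y₂ : Y, edist y₁ y₂ ≤ C)
    (y : Bool → Y) (n : ℕ) (u : ℕ → X) :
    edist (y false) (y true) / 2 * (⨅ k, Mh (ind (A k)) u) ≤
      ∫⁻ b, limsup (fun t => lossE f (labF A hA y b) n t u) atTop ∂coins := by
  have hc : edist (y false) (y true) / 2 ≠ ⊤ :=
    ENNReal.div_ne_top ((hC _ _).trans_lt hCt.lt_top).ne (by simp)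
  obtain ⟨K, hK⟩ : ∃ K, ∀ i < n, u i ∉ A K := by
    choose k hk using hA
    refine ⟨(Finset.range n).sup fun i => k (u i), fun i hi hmem => hk (u i) ?_⟩
    exact hanti (Finset.le_sup (f := fun i => k (u i)) (Finset.mem_range.2 hi)) hmem
  have hmeas : ∀ t, Measurable fun b => lossE f (labF A hA y b) n t u := fun t =>
    (measurable_lossE hf hAm hA y n t).comp (Measurable.prodMk measurable_id measurable_const)
  have hl := measurable_labF hAm hA y
  have hlab : ∀ i : ℕ, Measurable (fun b : ℕ → Bool => labF A hA y b (u i)) := fun i =>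
    hl.comp (Measurable.prodMk measurable_id measurable_const)
  have hterm : ∀ s, Measurable fun b => edist (f n (n + s) (fun i => u i.1)
      (fun i => labF A hA y b (u i.1)) (u (n + s))) (labF A hA y b (u (n + s))) := by
    intro s
    refine Measurable.edist ?_ (hlab _)
    have h1 : Measurable (fun b : ℕ → Bool =>
        ((fun i : Fin (n + s) => u i.1), ((fun i : Fin n => labF A hA y b (u i.1)),
          u (n + s)))) := by
      refine Measurable.prodMk measurable_const (Measurable.prodMk ?_ measurable_const)
      exact measurable_pi_iff.2 fun i => hlab _
    have h2 := (hf n (n + s) (by omega)).comp h1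
    exact h2
  calc edist (y false) (y true) / 2 * (⨅ k, Mh (ind (A k)) u)
      ≤ edist (y false) (y true) / 2 * limsup (fun t : ℕ =>
          (∑ s ∈ Finset.range (t + 1), ind (A K) (u (n + s))) / ((t : ℝ≥0∞) + 1)) atTop := by
        gcongr
        exact (iInf_le _ K).trans (limsup_shift _ (ind_le_one _) n u)
    _ = limsup (fun t : ℕ => edist (y false) (y true) / 2 *
          ((∑ s ∈ Finset.range (t + 1), ind (A K) (u (n + s))) / ((t : ℝ≥0∞) + 1))) atTop :=
        (ENNReal.limsup_const_mul_of_ne_top hc).symm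
    _ ≤ limsup (fun t => ∫⁻ b, lossE f (labF A hA y b) n t u ∂coins) atTop := by
        refine limsup_le_limsup (Eventually.of_forall fun t => ?_)
        show _ ≤ ∫⁻ b, lossE f (labF A hA y b) n t u ∂coins
        unfold lossE
        simp only [div_eq_mul_inv _ ((t : ℝ≥0∞) + 1)]
        rw [lintegral_mul_const _ (Finset.measurable_sum _ fun s _ => hterm s),
          lintegral_finsetSum _ (fun s _ => hterm s), ← mul_assoc, Finset.mul_sum]
        gcongr with s hs
        exact term_lower hA hanti y n s K u hK (hterm s)
    _ ≤ _ := limsup_lintegral_le (fun _ => C) hmeas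
        (fun t => Eventually.of_forall fun b => lossE_le f _ n t u C hC) (by simpa using hCt)

def lossG (f : ∀ n m : ℕ, (Fin m → X) → (Fin n → Y) → X → Y) (A : ℕ → Set X)
    (hA : ∀ x, ∃ k, x ∉ A k) (y : Bool → Y) (n : ℕ) (b : ℕ → Bool) (u : ℕ → X) : ℝ≥0∞ :=
  limsup (fun t => lossE f (labF A hA y b) n t u) atTop

lemma measurable_lossG [SecondCountableTopology Y]
    {f : ∀ n m : ℕ, (Fin m → X) → (Fin n → Y) → X → Y} (hf : IsSelfAdaptiveRule f)
    {A : ℕ → Set X} (hAm : ∀ k, MeasurableSet (A k)) (hA : ∀ x, ∃ k, x ∉ A k)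
    (y : Bool → Y) (n : ℕ) :
    Measurable (fun p : (ℕ → Bool) × (ℕ → X) => lossG f A hA y n p.1 p.2) := by
  have h := fun t => measurable_lossE hf hAm hA y n t
  unfold lossG
  exact Measurable.limsup h

lemma measurable_lossG_right [SecondCountableTopology Y]
    {f : ∀ n m : ℕ, (Fin m → X) → (Fin n → Y) → X → Y} (hf : IsSelfAdaptiveRule f)
    {A : ℕ → Set X} (hAm : ∀ k, MeasurableSet (A k)) (hA : ∀ x, ∃ k, x ∉ A k)
    (y : Bool → Y) (n : ℕ) (b : ℕ → Bool) : Measurable (lossG f A hA y n b) := by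
  have h1 : Measurable (fun u : ℕ → X => (b, u)) := Measurable.prodMk measurable_const measurable_id
  have h2 := (measurable_lossG hf hAm hA y n).comp h1
  exact h2

lemma measurable_labF_right {A : ℕ → Set X} (hAm : ∀ k, MeasurableSet (A k))
    (hA : ∀ x, ∃ k, x ∉ A k) (y : Bool → Y) (b : ℕ → Bool) : Measurable (labF A hA y b) := by
  have h1 : Measurable (fun u : X => (b, u)) := Measurable.prodMk measurable_const measurable_id
  have h2 := (measurable_labF hAm hA y).comp h1
  exact h2

lemma lossG_le (f : ∀ n m : ℕ, (Fin m → X) → (Fin n → Y) → X → Y) (A : ℕ → Set X)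
    (hA : ∀ x, ∃ k, x ∉ A k) (y : Bool → Y) (C : ℝ≥0∞) (hC : ∀ y₁ y₂ : Y, edist y₁ y₂ ≤ C)
    (n : ℕ) (b : ℕ → Bool) (u : ℕ → X) : lossG f A hA y n b u ≤ C := by
  unfold lossG
  exact limsup_le_of_le (h := Eventually.of_forall fun t => lossE_le f _ n t u _ hC)

lemma lossG_in [SecondCountableTopology Y] (C : ℝ) (hC : ∀ y₁ y₂ : Y, dist y₁ y₂ ≤ C)
    (μ : Measure (ℕ → X)) [IsProbabilityMeasure μ]
    {f : ∀ n m : ℕ, (Fin m → X) → (Fin n → Y) → X → Y} (hf : IsSelfAdaptiveRule f)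
    (hcons : StronglyConsistentAda μ f)
    {A : ℕ → Set X} (hAm : ∀ k, MeasurableSet (A k)) (hA : ∀ x, ∃ k, x ∉ A k)
    (y : Bool → Y) (b : ℕ → Bool) :
    Tendsto (fun n => ∫⁻ u, lossG f A hA y n b u ∂μ) atTop (𝓝 0) := by
  have hCE : ∀ y₁ y₂ : Y, edist y₁ y₂ ≤ ENNReal.ofReal C := fun a b => by
    rw [edist_dist]; exact ENNReal.ofReal_le_ofReal (hC a b)
  have hae : ∀ᵐ u ∂μ, Tendsto (fun n => lossG f A hA y n b u) atTop (𝓝 0) := by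
    filter_upwards [hcons _ (measurable_labF_right hAm hA y b)] with u hu
    have h0 : Tendsto (fun n => ENNReal.ofReal (adaLoss f (labF A hA y b) n u)) atTop (𝓝 0) := by
      simpa using ENNReal.tendsto_ofReal hu
    exact tendsto_of_tendsto_of_tendsto_of_le_of_le tendsto_const_nhds h0
      (fun _ => bot_le) (fun n => limsup_lossE_le f C hC _ n u)
  have hfin : ∫⁻ _u : ℕ → X, ENNReal.ofReal C ∂μ ≠ ⊤ := by simp
  have h1 : ∀ n, Measurable (lossG f A hA y n b) := fun n => measurable_lossG_right hf hAm hA y n b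
  have h2 : ∀ n, (lossG f A hA y n b) ≤ᵐ[μ] fun _ => ENNReal.ofReal C := fun n =>
    Eventually.of_forall fun u => lossG_le f A hA y _ hCE n b u
  have := tendsto_lintegral_of_dominated_convergence (fun _ => ENNReal.ofReal C) h1 h2 hfin hae
  simpa using this

lemma lossG_out [SecondCountableTopology Y] (C : ℝ) (hC : ∀ y₁ y₂ : Y, dist y₁ y₂ ≤ C)
    (μ : Measure (ℕ → X)) [IsProbabilityMeasure μ]
    {f : ∀ n m : ℕ, (Fin m → X) → (Fin n → Y) → X → Y} (hf : IsSelfAdaptiveRule f)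
    (hcons : StronglyConsistentAda μ f)
    {A : ℕ → Set X} (hAm : ∀ k, MeasurableSet (A k)) (hA : ∀ x, ∃ k, x ∉ A k)
    (y : Bool → Y) :
    Tendsto (fun n => ∫⁻ b, ∫⁻ u, lossG f A hA y n b u ∂μ ∂coins) atTop (𝓝 0) := by
  have hCE : ∀ y₁ y₂ : Y, edist y₁ y₂ ≤ ENNReal.ofReal C := fun a b => by
    rw [edist_dist]; exact ENNReal.ofReal_le_ofReal (hC a b)
  have hfin : ∫⁻ _u : ℕ → Bool, ENNReal.ofReal C ∂coins ≠ ⊤ := by simp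
  have h1 : ∀ n, Measurable (fun b => ∫⁻ u, lossG f A hA y n b u ∂μ) := fun n =>
    (measurable_lossG hf hAm hA y n).lintegral_prod_right'
  have h2 : ∀ n, (fun b => ∫⁻ u, lossG f A hA y n b u ∂μ) ≤ᵐ[coins] fun _ => ENNReal.ofReal C :=
    fun n => Eventually.of_forall fun b => by
      refine (lintegral_mono fun u => lossG_le f A hA y _ hCE n b u).trans ?_
      simp
  have := tendsto_lintegral_of_dominated_convergence (fun _ => ENNReal.ofReal C) h1 h2 hfin
    (Eventually.of_forall (lossG_in C hC μ hf hcons hAm hA y))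
  simpa using this

lemma sual_C1 [SecondCountableTopology Y] (C : ℝ) (hC : ∀ y₁ y₂ : Y, dist y₁ y₂ ≤ C)
    (hnt : ∃ y₁ y₂ : Y, 0 < dist y₁ y₂) (μ : Measure (ℕ → X)) [IsProbabilityMeasure μ]
    (h : SUAL Y μ) : C1 μ := by
  intro A hAm hanti hint
  obtain ⟨f, hf, hcons⟩ := h
  obtain ⟨y₁, y₂, hy⟩ := hnt
  have hA : ∀ x, ∃ k, x ∉ A k := by
    intro x
    by_contra hcon
    push Not at hcon
    have : x ∈ (⋂ k, A k) := Set.mem_iInter.2 hcon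
    rw [hint] at this
    exact this
  have hCE : ∀ y₁ y₂ : Y, edist y₁ y₂ ≤ ENNReal.ofReal C := fun a b => by
    rw [edist_dist]; exact ENNReal.ofReal_le_ofReal (hC a b)
  let y : Bool → Y := fun b => cond b y₁ y₂
  have hout := lossG_out C hC μ hf hcons hAm hA y
  have hMm : ∀ k, Measurable (Mh (ind (A k))) := fun k => measurable_Mh (measurable_ind (hAm k))
  have hZm : Measurable (fun u => ⨅ k, Mh (ind (A k)) u) := Measurable.iInf hMm
  have hlow : ∀ n, edist (y false) (y true) / 2 * ∫⁻ u, (⨅ k, Mh (ind (A k)) u) ∂μ ≤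
      ∫⁻ b, ∫⁻ u, lossG f A hA y n b u ∂μ ∂coins := by
    intro n
    rw [lintegral_lintegral_swap (measurable_lossG hf hAm hA y n).aemeasurable, ← lintegral_const_mul _ hZm]
    exact lintegral_mono fun u => path_lower hf hAm hA hanti _ ENNReal.ofReal_ne_top hCE y n u
  have hzero : edist (y false) (y true) / 2 * ∫⁻ u, (⨅ k, Mh (ind (A k)) u) ∂μ = 0 :=
    le_antisymm (ge_of_tendsto' hout hlow) bot_le
  have hne : edist (y false) (y true) / 2 ≠ 0 := by
    simp only [y, cond_false, cond_true]
    rw [Ne, ENNReal.div_eq_zero_iff]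
    have : y₂ ≠ y₁ := by rintro rfl; simp at hy
    simp [this]
  have hanti' : Antitone (fun k => Mh (ind (A k))) := fun k k' hk u =>
    Mh_mono (ind_mono (hanti hk)) u
  rw [lintegral_iInf hMm hanti' ] at hzero
  · have hz := (mul_eq_zero.1 hzero).resolve_left hne
    have ht := tendsto_atTop_iInf (f := fun k => ns μ (A k)) (fun k k' hk => ns_mono μ (hanti hk))
    have : (⨅ k, ns μ (A k)) = 0 := hz
    rw [this] at ht
    exact ht
  · refine ((lintegral_mono fun u => Mh_le_const 1 _ (ind_le_one _) u).trans_lt ?_).ne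
    simp

end OptNecessity
/-- **Theorem 1 (Hanneke).** There exists an optimistically universal self-adaptive
learning rule: a single self-adaptive learning rule that is strongly universally
consistent under every process that admits strong universal self-adaptive learning. -/
theorem exists_optimistically_universal_self_adaptive (X Y : Type*)
    [TopologicalSpace X] [TopologicalSpace.MetrizableSpace X]
    [TopologicalSpace.SeparableSpace X] [Nonempty X] [MeasurableSpace X] [BorelSpace X]
    [MetricSpace Y] [TopologicalSpace.SeparableSpace Y] [Nonempty Y]
    [MeasurableSpace Y] [BorelSpace Y]
    (hbdd : ∃ C : ℝ, ∀ y₁ y₂ : Y, dist y₁ y₂ ≤ C)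
    (hnontriv : ∃ y₁ y₂ : Y, 0 < dist y₁ y₂) :
    ∃ f : ∀ n m : ℕ, (Fin m → X) → (Fin n → Y) → X → Y,
      IsSelfAdaptiveRule f ∧
        ∀ μ : Measure (ℕ → X), IsProbabilityMeasure μ → SUAL Y μ →
          StronglyConsistentAda μ f := by
  letI := TopologicalSpace.metrizableSpaceMetric X
  haveI : SecondCountableTopology X := UniformSpace.secondCountable_of_separable X
  haveI : SecondCountableTopology Y := UniformSpace.secondCountable_of_separable Y
  obtain ⟨C, hC⟩ := hbdd
  have hCE : ∀ y₁ y₂ : Y, edist y₁ y₂ ≤ ENNReal.ofReal C := fun a b => by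
    rw [edist_dist]; exact ENNReal.ofReal_le_ofReal (hC a b)
  obtain ⟨T, hT⟩ := exists_goodSeq (X := X)
  let yd : ℕ → Y := TopologicalSpace.denseSeq Y
  have hyd : DenseRange yd := TopologicalSpace.denseRange_denseSeq Y
  let g : ℕ → X → Y := fun i =>
    dl yd (listT T (((Encodable.decode i : Option (List (ℕ × ℕ)))).getD []))
  have hg : ∀ i, Measurable (g i) := fun i => measurable_dlT hT yd _
  let x0 : X := Classical.arbitrary X
  let y0 : Y := Classical.arbitrary Y
  refine ⟨ruleF g x0 y0, measurable_ruleF g hg x0 y0, fun μ hμ hS fs hfs => ?_⟩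
  have hC1 := sual_C1 C hC hnontriv μ hS
  have happ : ∀ ε : ENNReal, 0 < ε →
      ∃ i, ∫⁻ u, Mh (fun x => edist (g i x) (fs x)) u ∂μ ≤ ε + (ε + ε) := by
    intro ε hε
    obtain ⟨L, hL⟩ := approx_fun hT hC1 yd hyd _ ENNReal.ofReal_ne_top hCE fs hfs ε hε
    refine ⟨Encodable.encode L, ?_⟩
    simpa [g] using hL
  have hMm : ∀ i, Measurable (Mh (fun x => edist (g i x) (fs x))) := fun i =>
    measurable_Mh ((hg i).edist hfs)
  have hzero : ∫⁻ u, (⨅ i, Mh (fun x => edist (g i x) (fs x)) u) ∂μ = 0 := by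
    refine le_antisymm (ENNReal.le_of_forall_pos_le_add fun ε hε _ => ?_) bot_le
    have hε3 : (0 : ENNReal) < ε / 3 := by
      refine ENNReal.div_pos ?_ (by simp)
      exact_mod_cast hε.ne'
    obtain ⟨i, hi⟩ := happ (ε / 3) hε3
    refine (lintegral_mono fun u => iInf_le _ i).trans (hi.trans ?_)
    rw [zero_add, ← add_assoc, ENNReal.add_thirds]
  rw [lintegral_eq_zero_iff (Measurable.iInf hMm)] at hzero
  filter_upwards [hzero] with u hu
  have hu' : (⨅ i, Mh (fun x => edist (g i x) (fs x)) u) = 0 := hu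
  rw [Metric.tendsto_nhds]
  intro ε hε
  have hε6 : (0 : ENNReal) < ENNReal.ofReal (ε / 6) := ENNReal.ofReal_pos.2 (by positivity)
  obtain ⟨i, hi⟩ := iInf_lt_iff.1 (hu'.trans_lt hε6)
  have hev := eventually_lt_of_limsup_lt hi
  obtain ⟨s0, hs0⟩ := eventually_atTop.1 hev
  have hpath := path_main g C hC x0 y0 u fs (ε / 6) (by positivity) i (s0 + 1) (by
    intro s hs
    have h1 := (hs0 s (by omega)).le
    have hspos : (0 : ℝ) < s := by exact_mod_cast (by omega : 0 < s)
    unfold avgD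
    rw [← ENNReal.ofReal_le_ofReal_iff (by positivity), ENNReal.ofReal_div_of_pos hspos,
      ENNReal.ofReal_sum_of_nonneg (fun _ _ => dist_nonneg), ENNReal.ofReal_natCast]
    simpa only [edist_dist] using h1)
  filter_upwards [hpath] with n hn
  rw [Real.dist_eq, sub_zero, abs_of_nonneg (adaLoss_nonneg _ C hC fs n u)]
  linarith
end

section
/- If X is uncountable and its topology is Polish, then there does not exist an optimistically universal inductive learning rule: for every inductive learning rule f_n there exists a process 𝕏 ∈ SUIL under which f_n is not strongly universally consistent. -/
open MeasureTheory Filter Topology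

/-- An inductive learning rule: a sequence of measurable functions
`f_n : X^n × Y^n × X → Y`. -/
def IsInductiveRule {X Y : Type*} [MeasurableSpace X] [MeasurableSpace Y]
    (f : ∀ n : ℕ, (Fin n → X) → (Fin n → Y) → X → Y) : Prop :=
  ∀ n : ℕ, Measurable fun p : (Fin n → X) × (Fin n → Y) × X => f n p.1 p.2.1 p.2.2

/-- The long-run average loss `L̂_𝕏(f_n, f*; n)` of an inductive learning rule along the
path `x` (0-indexed, so `x 0, x 1, …` are `X_1, X_2, …`):
`limsup_{t→∞} (1/t) ∑_{m=n+1}^{n+t} ℓ(f_n(X_{1:n}, f*(X_{1:n}), X_m), f*(X_m))`. -/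
noncomputable def indLoss {X Y : Type*} [PseudoMetricSpace Y]
    (f : ∀ n : ℕ, (Fin n → X) → (Fin n → Y) → X → Y)
    (fstar : X → Y) (n : ℕ) (x : ℕ → X) : ℝ :=
  Filter.limsup
    (fun t : ℕ =>
      (∑ s ∈ Finset.range t,
          dist (f n (fun i => x i.1) (fun i => fstar (x i.1)) (x (n + s)))
            (fstar (x (n + s)))) / (t : ℝ))
    Filter.atTop

/-- Strong universal consistency of an inductive learning rule under the process with
law `μ`: for every measurable target `f*`, `L̂_𝕏(f_n, f*; n) → 0` almost surely. -/
def StronglyConsistentInd {X Y : Type*} [MeasurableSpace X] [MeasurableSpace Y]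
    [PseudoMetricSpace Y] (μ : Measure (ℕ → X))
    (f : ∀ n : ℕ, (Fin n → X) → (Fin n → Y) → X → Y) : Prop :=
  ∀ fstar : X → Y, Measurable fstar →
    ∀ᵐ x ∂μ, Tendsto (fun n => indLoss f fstar n x) atTop (𝓝 0)

/-- `SUIL`: the process with law `μ` admits strong universal inductive learning. -/
def SUIL {X : Type*} (Y : Type*) [MeasurableSpace X] [MeasurableSpace Y] [PseudoMetricSpace Y]
    (μ : Measure (ℕ → X)) : Prop :=
  ∃ f : ∀ n : ℕ, (Fin n → X) → (Fin n → Y) → X → Y,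
    IsInductiveRule f ∧ StronglyConsistentInd μ f


namespace NoOpt

noncomputable def avg (a : ℕ → ℝ) (t : ℕ) : ℝ := (∑ s ∈ Finset.range t, a s) / (t : ℝ)

lemma avg_congr_ev {a b : ℕ → ℝ} {L : ℝ} (hab : ∀ᶠ s in atTop, a s = b s)
    (h : Tendsto (avg a) atTop (𝓝 L)) : Tendsto (avg b) atTop (𝓝 L) := by
  have h1 : Tendsto (fun s => b s - a s) atTop (𝓝 0) := by
    refine tendsto_const_nhds.congr' ?_
    filter_upwards [hab] with s hs
    rw [hs, sub_self]
  have h2 := h1.cesaro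
  have h3 := h.add h2
  rw [add_zero] at h3
  refine h3.congr fun t => ?_
  simp only [avg, Finset.sum_sub_distrib]
  ring

lemma avg_of_ev_const {a : ℕ → ℝ} {L : ℝ} (h : ∀ᶠ s in atTop, a s = L) :
    Tendsto (avg a) atTop (𝓝 L) := by
  have h1 : Tendsto a atTop (𝓝 L) := by
    refine tendsto_const_nhds.congr' ?_
    filter_upwards [h] with s hs
    rw [hs]
  refine h1.cesaro.congr fun t => ?_
  simp only [avg]; ring

lemma avg_shift {a : ℕ → ℝ} {L : ℝ} (n : ℕ) (h : Tendsto (avg a) atTop (𝓝 L)) :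
    Tendsto (avg (fun s => a (n + s))) atTop (𝓝 L) := by
  have h1 : Tendsto (fun t : ℕ => avg a (t + n)) atTop (𝓝 L) := (tendsto_add_atTop_iff_nat n).2 h
  have h2 : Tendsto (fun t : ℕ => ((t + n : ℕ) : ℝ) / (t : ℝ)) atTop (𝓝 1) := by
    have : Tendsto (fun t : ℕ => 1 + (n : ℝ) / (t : ℝ)) atTop (𝓝 (1 + 0)) :=
      tendsto_const_nhds.add (tendsto_const_div_atTop_nhds_zero_nat _)
    rw [add_zero] at this
    refine this.congr' ?_
    filter_upwards [eventually_gt_atTop 0] with t ht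
    have : (t : ℝ) ≠ 0 := by positivity
    push_cast; field_simp
  have h3 : Tendsto (fun t : ℕ => (∑ s ∈ Finset.range n, a s) / (t : ℝ)) atTop (𝓝 0) :=
    tendsto_const_div_atTop_nhds_zero_nat _
  have h4 := (h1.mul h2).sub h3
  rw [mul_one, sub_zero] at h4
  refine h4.congr' ?_
  filter_upwards [eventually_gt_atTop 0] with t ht
  have ht' : (t : ℝ) ≠ 0 := by positivity
  have ht2 : ((t + n : ℕ) : ℝ) ≠ 0 := by positivity
  simp only [avg]
  rw [add_comm t n, Finset.sum_range_add]
  rw [add_comm t n] at ht2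
  field_simp
  ring

lemma sum_blocks (a : ℕ → ℝ) (p M : ℕ) :
    ∑ s ∈ Finset.range (p * M), a s
      = ∑ i ∈ Finset.range p, ∑ m ∈ Finset.range M, a (p * m + i) := by
  induction M with
  | zero => simp
  | succ M ih =>
    rw [Nat.mul_succ, Finset.sum_range_add, ih]
    simp only [Finset.sum_range_succ, Finset.sum_add_distrib]

lemma avg_res {a : ℕ → ℝ} {C : ℝ} (h0 : ∀ s, 0 ≤ a s) (hC : ∀ s, a s ≤ C) {p : ℕ} (hp : 0 < p)
    {L : ℕ → ℝ} (h : ∀ i < p, Tendsto (avg (fun m => a (p * m + i))) atTop (𝓝 (L i))) :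
    Tendsto (avg a) atTop (𝓝 ((∑ i ∈ Finset.range p, L i) / p)) := by
  have hp' : (0 : ℝ) < p := by exact_mod_cast hp
  have h1 : Tendsto (fun M => ∑ i ∈ Finset.range p, avg (fun m => a (p * m + i)) M) atTop
      (𝓝 (∑ i ∈ Finset.range p, L i)) :=
    tendsto_finsetSum _ fun i hi => h i (Finset.mem_range.1 hi)
  have hdiv : Tendsto (fun t : ℕ => t / p) atTop atTop :=
    Nat.tendsto_div_const_atTop hp.ne'
  have h2 := h1.comp hdiv
  -- (t/p)/t → 1/p
  have h3 : Tendsto (fun t : ℕ => ((t / p : ℕ) : ℝ) / (t : ℝ)) atTop (𝓝 (1 / p)) := by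
    have hl : Tendsto (fun t : ℕ => 1 / (p : ℝ) - 1 / (t : ℝ)) atTop (𝓝 (1 / p - 0)) :=
      tendsto_const_nhds.sub (tendsto_const_div_atTop_nhds_zero_nat _)
    rw [sub_zero] at hl
    refine tendsto_of_tendsto_of_tendsto_of_le_of_le' hl tendsto_const_nhds ?_ ?_
    · filter_upwards [eventually_gt_atTop 0] with t ht
      have ht' : (0 : ℝ) < t := by exact_mod_cast ht
      have h5 : t < p * (t / p) + p := by
        have := Nat.div_add_mod t p
        have := Nat.mod_lt t hp
        omega
      have h6 : (t : ℝ) < p * ((t / p : ℕ) : ℝ) + p := by exact_mod_cast h5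
      rw [div_sub_div _ _ hp'.ne' ht'.ne', div_le_div_iff₀ (by positivity) ht']
      nlinarith
    · filter_upwards [eventually_gt_atTop 0] with t ht
      have ht' : (0 : ℝ) < t := by exact_mod_cast ht
      have h5 : p * (t / p) ≤ t := Nat.mul_div_le t p
      have h6 : p * ((t / p : ℕ) : ℝ) ≤ t := by exact_mod_cast h5
      rw [div_le_div_iff₀ ht' hp']
      nlinarith
  have h4 := h2.mul h3
  have h5 : Tendsto (fun t : ℕ => (∑ i ∈ Finset.range (t % p), a (p * (t / p) + i)) / (t : ℝ)) atTop
      (𝓝 0) := by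
    have hu : Tendsto (fun t : ℕ => (p * C) / (t : ℝ)) atTop (𝓝 0) :=
      tendsto_const_div_atTop_nhds_zero_nat _
    refine squeeze_zero (fun t => div_nonneg (Finset.sum_nonneg fun _ _ => h0 _) (by positivity))
      (fun t => ?_) hu
    have hC0 : 0 ≤ C := (h0 0).trans (hC 0)
    gcongr
    calc ∑ i ∈ Finset.range (t % p), a (p * (t / p) + i)
        ≤ ∑ i ∈ Finset.range (t % p), C := Finset.sum_le_sum fun _ _ => hC _
      _ = (t % p : ℕ) * C := by simp
      _ ≤ p * C := by
        gcongr
        exact (Nat.mod_lt t hp).le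
  have h6 := h4.add h5
  rw [add_zero, mul_one_div] at h6
  refine h6.congr' ?_
  filter_upwards [eventually_ge_atTop p] with t ht
  have ht' : (t : ℝ) ≠ 0 := by
    have : 0 < t := by omega
    positivity
  have hd : ((t / p : ℕ) : ℝ) ≠ 0 := by
    have : 0 < t / p := Nat.div_pos ht hp
    positivity
  have hs : ∑ s ∈ Finset.range t, a s = ∑ i ∈ Finset.range p, ∑ m ∈ Finset.range (t / p), a (p * m + i)
      + ∑ i ∈ Finset.range (t % p), a (p * (t / p) + i) := by
    rw [← sum_blocks, ← Finset.sum_range_add, Nat.div_add_mod]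
  simp only [avg, Function.comp]
  rw [hs, ← Finset.sum_div]
  field_simp

/-- periodic block averaging -/
lemma avg_per {κ : ℕ → ℕ} (hj : ∀ t, κ (t+1) ≠ κ t → 2 ^ κ t ∣ t + 1 ∧ 2 ^ κ (t+1) ∣ t + 1)
    (hs : ∀ t, 1 ≤ t → 4 ^ κ t ≤ t) (hκ : Tendsto κ atTop atTop)
    {ψ : ℕ → ℕ → ℝ} {C : ℝ} (h0 : ∀ j i, 0 ≤ ψ j i) (hC : ∀ j i, ψ j i ≤ C) {L : ℝ}
    (hA : Tendsto (fun j => avg (ψ j) (2 ^ j)) atTop (𝓝 L)) :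
    Tendsto (avg (fun s => ψ (κ s) (s % 2 ^ κ s))) atTop (𝓝 L) := by
  have hC0 : 0 ≤ C := (h0 0 0).trans (hC 0 0)
  set A : ℕ → ℝ := fun j => avg (ψ j) (2 ^ j) with hAdef
  have hA0 : ∀ j, 0 ≤ A j := fun j =>
    div_nonneg (Finset.sum_nonneg fun _ _ => h0 _ _) (by positivity)
  have hAC : ∀ j, A j ≤ C := fun j => by
    simp only [hAdef, avg]
    rw [div_le_iff₀ (by positivity)]
    calc ∑ s ∈ Finset.range (2^j), ψ j s ≤ ∑ s ∈ Finset.range (2^j), C :=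
          Finset.sum_le_sum fun _ _ => hC _ _
      _ = C * ((2^j : ℕ) : ℝ) := by simp [mul_comm]
  let R : ℕ → ℕ → ℝ := fun j r => ∑ i ∈ Finset.range r, (ψ j i - A j)
  have hRp : ∀ j, R j (2 ^ j) = 0 := fun j => by
    simp only [R, Finset.sum_sub_distrib, hAdef, avg]
    simp
    field_simp
    ring
  have hR0 : ∀ j, R j 0 = 0 := fun j => by simp [R]
  have hstep : ∀ j s, R j (s % 2 ^ j) + (ψ j (s % 2 ^ j) - A j) = R j ((s + 1) % 2 ^ j) := by
    intro j s
    have hpos : 0 < 2 ^ j := by positivity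
    have e1 : R j (s % 2 ^ j) + (ψ j (s % 2 ^ j) - A j) = R j (s % 2 ^ j + 1) := by
      simp only [R, Finset.sum_range_succ]
    rw [e1]
    have hlt := Nat.mod_lt s hpos
    rcases Nat.lt_or_ge (s % 2 ^ j + 1) (2 ^ j) with h | h
    · congr 1
      rw [Nat.add_mod, Nat.mod_eq_of_lt (a := s % 2^j + 1 % 2^j)]
      · rw [Nat.mod_eq_of_lt (a := 1)]; omega
      · rw [Nat.mod_eq_of_lt (a := 1)] <;> omega
    · have h1 : s % 2 ^ j + 1 = 2 ^ j := by omega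
      have h2 : (s + 1) % 2 ^ j = 0 := by
        have := Nat.div_add_mod s (2 ^ j)
        apply Nat.mod_eq_zero_of_dvd
        refine ⟨s / 2 ^ j + 1, ?_⟩
        rw [mul_add]; omega
      rw [h1, h2, hRp, hR0]
  have key : ∀ t, ∑ s ∈ Finset.range t, ψ (κ s) (s % 2 ^ κ s)
      = ∑ s ∈ Finset.range t, A (κ s) + R (κ t) (t % 2 ^ κ t) := by
    intro t
    induction t with
    | zero => simp [R]
    | succ t ih =>
      rw [Finset.sum_range_succ, Finset.sum_range_succ, ih]
      have := hstep (κ t) t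
      have e2 : R (κ t) ((t+1) % 2 ^ κ t) = R (κ (t+1)) ((t+1) % 2 ^ κ (t+1)) := by
        by_cases h : κ (t+1) = κ t
        · rw [h]
        · obtain ⟨d1, d2⟩ := hj t h
          rw [Nat.mod_eq_zero_of_dvd d1, Nat.mod_eq_zero_of_dvd d2, hR0, hR0]
      rw [← e2, ← this]; ring
  have hRb : ∀ t, |R (κ t) (t % 2 ^ κ t)| ≤ 2 ^ κ t * C := by
    intro t
    calc |R (κ t) (t % 2 ^ κ t)| ≤ ∑ i ∈ Finset.range (t % 2 ^ κ t), |ψ (κ t) i - A (κ t)| :=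
          Finset.abs_sum_le_sum_abs _ _
      _ ≤ ∑ i ∈ Finset.range (t % 2 ^ κ t), C := Finset.sum_le_sum fun i _ => by
          rw [abs_le]
          constructor <;> linarith [h0 (κ t) i, hC (κ t) i, hA0 (κ t), hAC (κ t)]
      _ = (t % 2 ^ κ t : ℕ) * C := by simp
      _ ≤ 2 ^ κ t * C := by
          gcongr
          exact_mod_cast (Nat.mod_lt t (by positivity)).le
  have h1 : Tendsto (fun t : ℕ => R (κ t) (t % 2 ^ κ t) / (t : ℝ)) atTop (𝓝 0) := by
    have hb : Tendsto (fun t : ℕ => C * (1 / 2 : ℝ) ^ κ t) atTop (𝓝 (C * 0)) :=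
      ((tendsto_pow_atTop_nhds_zero_of_lt_one (by norm_num) (by norm_num)).comp hκ).const_mul C
    rw [mul_zero] at hb
    refine squeeze_zero_norm' ?_ hb
    filter_upwards [eventually_ge_atTop 1] with t ht
    have ht' : (0 : ℝ) < t := by exact_mod_cast ht
    have h4 : (4 : ℝ) ^ κ t ≤ t := by exact_mod_cast hs t ht
    rw [Real.norm_eq_abs, abs_div, abs_of_pos ht', div_le_iff₀ ht']
    refine (hRb t).trans ?_
    have : (2 : ℝ) ^ κ t = (1/2) ^ κ t * 4 ^ κ t := by rw [← mul_pow]; norm_num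
    calc (2 : ℝ) ^ κ t * C = C * (1/2) ^ κ t * 4 ^ κ t := by rw [this]; ring
      _ ≤ C * (1/2) ^ κ t * t := by gcongr
  have h2 := ((hA.comp hκ).cesaro).add h1
  rw [add_zero] at h2
  refine h2.congr fun t => ?_
  simp only [avg, key t, Function.comp]
  simp only [hAdef, avg]
  ring

end NoOpt

namespace NoOpt

open ProbabilityTheory

lemma integrable_bdd {Ω : Type*} [MeasurableSpace Ω] {μ : Measure Ω} [IsFiniteMeasure μ]
    {φ : Ω → ℝ} (hφ : Measurable φ) {C : ℝ} (h0 : ∀ x, 0 ≤ φ x) (hC : ∀ x, φ x ≤ C) :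
    Integrable φ μ := by
  refine Integrable.of_bound hφ.aestronglyMeasurable C (ae_of_all _ fun x => ?_)
  rw [Real.norm_eq_abs, abs_of_nonneg (h0 x)]
  exact hC x

section
variable {X ι : Type*} [MeasurableSpace X] (π : Measure X) [IsProbabilityMeasure π]

noncomputable abbrev iid (ι : Type*) : Measure (ι → X) := Measure.infinitePi (fun _ : ι => π)

variable {φ : X → ℝ} (hφ : Measurable φ) {C : ℝ} (h0 : ∀ x, 0 ≤ φ x) (hC : ∀ x, φ x ≤ C)

include hφ in
lemma iid_integral (i : ι) : ∫ ω, φ (ω i) ∂(iid π ι) = ∫ x, φ x ∂π := by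
  have h := Measure.infinitePi_map_eval (fun _ : ι => π) i
  conv_rhs => rw [← h]
  rw [integral_map (measurable_pi_apply i).aemeasurable hφ.aestronglyMeasurable]

include hφ in
lemma iid_indep {e : ℕ → ι} (he : Function.Injective e) :
    iIndepFun (fun q (ω : ι → X) => φ (ω (e q))) (iid π ι) :=
  iIndepFun.precomp he (iIndepFun_infinitePi (X := fun _ x => φ x) (fun _ => hφ))

include hφ h0 hC in
lemma iid_slln {e : ℕ → ι} (he : Function.Injective e) :
    ∀ᵐ ω ∂(iid π ι), Tendsto (avg (fun q => φ (ω (e q)))) atTop (𝓝 (∫ x, φ x ∂π)) := by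
  have h := strong_law_ae_real (μ := iid π ι) (fun q ω => φ (ω (e q)))
    (integrable_bdd (by fun_prop) (fun _ => h0 _) (fun _ => hC _))
    (fun i j hij => (iid_indep π hφ he).indepFun hij)
    (fun i => by
      refine ⟨(hφ.comp (measurable_pi_apply _)).aemeasurable,
        (hφ.comp (measurable_pi_apply _)).aemeasurable, ?_⟩
      have e1 : ∀ j : ι, (iid π ι).map (fun ω => φ (ω j)) = π.map φ := fun j => by
        conv_rhs => rw [← Measure.infinitePi_map_eval (fun _ : ι => π) j]
        rw [Measure.map_map hφ (measurable_pi_apply j)]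
        rfl
      rw [e1, e1])
  simp only [iid_integral π hφ] at h
  exact h

include hφ h0 hC in
lemma iid_var {e : ℕ → ι} (he : Function.Injective e) {M : ℕ} (hM : 0 < M) :
    ∫⁻ ω, ENNReal.ofReal ((avg (fun q => φ (ω (e q))) M - ∫ x, φ x ∂π) ^ 2) ∂(iid π ι)
      ≤ ENNReal.ofReal (C ^ 2 / M) := by
  have hM' : (0 : ℝ) < M := by exact_mod_cast hM
  set Z : ℕ → (ι → X) → ℝ := fun q ω => φ (ω (e q)) with hZ
  have hmem : ∀ q, MemLp (Z q) 2 (iid π ι) := fun q =>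
    MemLp.of_bound (by fun_prop) C (ae_of_all _ fun x => by
      rw [Real.norm_eq_abs, abs_of_nonneg (h0 _)]; exact hC _)
  have hv := IndepFun.variance_sum (μ := iid π ι) (X := Z) (s := Finset.range M) (fun i _ => hmem i)
    (fun i _ j _ hij => (iid_indep π hφ he).indepFun hij)
  have hv1 : ∀ q, variance (Z q) (iid π ι) ≤ C ^ 2 := fun q => by
    have := variance_le_sq_of_bounded (μ := iid π ι) (X := Z q) (a := 0) (b := C)
      (ae_of_all _ fun x => ⟨h0 _, hC _⟩) (by fun_prop)
    nlinarith [sq_nonneg C]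
  have hsum : variance (∑ q ∈ Finset.range M, Z q) (iid π ι) ≤ M * C ^ 2 := by
    rw [hv]
    calc _ ≤ ∑ q ∈ Finset.range M, C ^ 2 := Finset.sum_le_sum fun q _ => hv1 q
      _ = M * C ^ 2 := by simp
  have hint : ∫ ω, (∑ q ∈ Finset.range M, Z q) ω ∂(iid π ι) = M * ∫ x, φ x ∂π := by
    simp only [Finset.sum_apply]
    rw [integral_finsetSum _ fun q _ => (hmem q).integrable (by norm_num)]
    simp [hZ, iid_integral π hφ]
  rw [← ofReal_integral_eq_lintegral_ofReal]
  · apply ENNReal.ofReal_le_ofReal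
    have hv2 := variance_eq_integral (μ := iid π ι) (X := ∑ q ∈ Finset.range M, Z q)
      (Finset.aemeasurable_sum _ fun q _ => (hmem q).1.aemeasurable)
    rw [hint] at hv2
    have e2 : ∀ ω : ι → X, (avg (fun q => φ (ω (e q))) M - ∫ x, φ x ∂π) ^ 2
        = ((∑ q ∈ Finset.range M, Z q) ω - M * ∫ x, φ x ∂π) ^ 2 / (M:ℝ) ^ 2 := fun ω => by
      simp only [avg, Finset.sum_apply, hZ]
      field_simp
    simp only [e2]
    rw [integral_div, ← hv2, div_le_div_iff₀ (by positivity) hM']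
    nlinarith [sq_nonneg C]
  · have hm : Measurable (fun ω : ι → X => avg (fun q => φ (ω (e q))) M) := by
      unfold avg; fun_prop
    refine Integrable.of_bound ((hm.sub_const _).pow_const 2).aestronglyMeasurable (C ^ 2) (ae_of_all _ fun ω => ?_)
    rw [Real.norm_eq_abs, abs_of_nonneg (sq_nonneg _)]
    have a1 : 0 ≤ avg (fun q => φ (ω (e q))) M :=
      div_nonneg (Finset.sum_nonneg fun _ _ => h0 _) hM'.le
    have a2 : avg (fun q => φ (ω (e q))) M ≤ C := by
      rw [avg, div_le_iff₀ hM']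
      calc _ ≤ ∑ q ∈ Finset.range M, C := Finset.sum_le_sum fun q _ => hC _
        _ = C * M := by simp [mul_comm]
    have b1 : 0 ≤ ∫ x, φ x ∂π := integral_nonneg h0
    have b2 : ∫ x, φ x ∂π ≤ C := by
      calc ∫ x, φ x ∂π ≤ ∫ x, C ∂π :=
            integral_mono (integrable_bdd hφ h0 hC) (integrable_const _) hC
        _ = C := by simp
    apply sq_le_sq'  <;> linarith
  · exact ae_of_all _ fun _ => sq_nonneg _

/-- merging -/
noncomputable def merge (S : Set ι) (a b : ι → X) : ι → X := by
  classical exact fun i => if i ∈ S then a i else b i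

omit [IsProbabilityMeasure π] in
lemma measurable_merge (S : Set ι) :
    Measurable (fun p : (ι → X) × (ι → X) => merge S p.1 p.2) := by
  classical
  refine measurable_pi_lambda _ fun i => ?_
  unfold merge
  by_cases h : i ∈ S
  · simp only [h, if_true]; fun_prop
  · simp only [h, if_false]; fun_prop

lemma merge_map (S : Set ι) :
    ((iid π ι).prod (iid π ι)).map (fun p => merge S p.1 p.2) = iid π ι := by
  classical
  apply Measure.eq_infinitePi
  intro s t ht
  rw [Measure.map_apply (measurable_merge S) (MeasurableSet.pi s.countable_toSet fun i _ => ht i)]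
  have : (fun p : (ι → X) × (ι → X) => merge S p.1 p.2) ⁻¹' (Set.pi s t)
      = (Set.pi (s.filter (· ∈ S)) t) ×ˢ (Set.pi (s.filter (· ∉ S)) t) := by
    ext p
    simp only [Set.mem_preimage, Set.mem_pi, Set.mem_prod, merge, Finset.coe_filter,
      Finset.mem_coe, Set.mem_ofPred_eq]
    constructor
    · intro h
      refine ⟨fun i hi => ?_, fun i hi => ?_⟩
      · have := h i hi.1; rwa [if_pos hi.2] at this
      · have := h i hi.1; rwa [if_neg hi.2] at this
    · rintro ⟨h1, h2⟩ i hi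
      by_cases h : i ∈ S
      · rw [if_pos h]; exact h1 i ⟨hi, h⟩
      · rw [if_neg h]; exact h2 i ⟨hi, h⟩
  rw [this, Measure.prod_prod, Measure.infinitePi_pi _ (fun i _ => ht i),
    Measure.infinitePi_pi _ (fun i _ => ht i), Finset.prod_filter_mul_prod_filter_not]

lemma merge_ae (S : Set ι) {R : Set (ι → X)} (hR : MeasurableSet R)
    (h : ∀ a, ∀ᵐ b ∂(iid π ι), merge S a b ∈ R) : ∀ᵐ ω ∂(iid π ι), ω ∈ R := by
  rw [← merge_map π S]
  refine (ae_map_iff (p := fun ω => ω ∈ R) (measurable_merge S).aemeasurable hR).2 ?_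
  have hm : MeasurableSet {p : (ι → X) × (ι → X) | merge S p.1 p.2 ∈ R} := measurable_merge S hR
  rw [Measure.ae_prod_iff_ae_ae hm]
  exact ae_of_all _ h

lemma iid_notMem [NullSingletonClass π] [Countable ι] {T : Set X} (hT : T.Countable) :
    ∀ᵐ ω ∂(iid π ι), ∀ i, ω i ∉ T := by
  rw [ae_all_iff]
  intro i
  have h := Measure.infinitePi_map_eval (fun _ : ι => π) i
  have : ∀ᵐ x ∂((iid π ι).map (fun ω => ω i)), x ∉ T := by
    rw [h]; exact hT.ae_notMem π
  exact ae_of_ae_map (f := fun ω : ι → X => ω i) (p := fun x => x ∉ T) (measurable_pi_apply i).aemeasurable this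

end

/-- second moment summable implies a.s. convergence to zero -/
lemma ae_tendsto_of_sq {Ω : Type*} [MeasurableSpace Ω] {μ : Measure Ω} {e : ℕ → Ω → ℝ}
    (he : ∀ m, Measurable (e m)) {r : ℕ → ℝ} (hr : Summable r) (hr0 : ∀ m, 0 ≤ r m)
    (h : ∀ m, ∫⁻ ω, ENNReal.ofReal (e m ω ^ 2) ∂μ ≤ ENNReal.ofReal (r m)) :
    ∀ᵐ ω ∂μ, Tendsto (fun m => e m ω) atTop (𝓝 0) := by
  have h1 : ∫⁻ ω, ∑' m, ENNReal.ofReal (e m ω ^ 2) ∂μ ≠ ⊤ := by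
    rw [lintegral_tsum (fun m => by fun_prop)]
    refine ne_top_of_le_ne_top ?_ (ENNReal.tsum_le_tsum h)
    rw [← ENNReal.ofReal_tsum_of_nonneg hr0 hr]
    exact ENNReal.ofReal_ne_top
  have h2 := ae_lt_top (Measurable.tsum fun m => by fun_prop) h1
  filter_upwards [h2] with ω hω
  have h3 := ENNReal.tendsto_atTop_zero_of_tsum_ne_top hω.ne
  have h4 : Tendsto (fun m => (ENNReal.ofReal (e m ω ^ 2)).toReal) atTop (𝓝 0) := by
    have := (ENNReal.tendsto_toReal ENNReal.zero_ne_top).comp h3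
    rw [ENNReal.toReal_zero] at this
    exact this
  have h5 : Tendsto (fun m => e m ω ^ 2) atTop (𝓝 0) := by
    refine h4.congr fun m => ENNReal.toReal_ofReal (sq_nonneg _)
  have h6 := h5.sqrt
  rw [Real.sqrt_zero] at h6
  rw [tendsto_zero_iff_abs_tendsto_zero]
  refine h6.congr fun m => Real.sqrt_sq_eq_abs _

end NoOpt

namespace NoOpt

open scoped ENNReal symmDiff

section
variable {X Y : Type*} [MeasurableSpace X] [MetricSpace Y]
  [TopologicalSpace.SeparableSpace Y] [Nonempty Y] [MeasurableSpace Y] [BorelSpace Y]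

open Classical in
/-- levels of the countable family -/
noncomputable def fam (𝒜 : Set (Set X)) (D : Set Y) : ℕ → Set (X → Y)
  | 0 => (fun y (_ : X) => y) '' D
  | k + 1 => fam 𝒜 D k ∪
      (fun q : Set X × (X → Y) × (X → Y) => q.1.piecewise q.2.1 q.2.2) ''
        (𝒜 ×ˢ (fam 𝒜 D k ×ˢ fam 𝒜 D k))

omit [TopologicalSpace.SeparableSpace Y] [Nonempty Y] [BorelSpace Y] [MetricSpace Y]
  [MeasurableSpace X] [MeasurableSpace Y] in
lemma fam_countable {𝒜 : Set (Set X)} {D : Set Y} (h𝒜 : 𝒜.Countable) (hD : D.Countable) (k : ℕ) :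
    (fam 𝒜 D k).Countable := by
  induction k with
  | zero => exact hD.image _
  | succ k ih => exact ih.union ((h𝒜.prod (ih.prod ih)).image _)

omit [TopologicalSpace.SeparableSpace Y] [Nonempty Y] [BorelSpace Y] [MetricSpace Y] in
lemma fam_measurable {𝒜 : Set (Set X)} {D : Set Y} (h𝒜 : ∀ s ∈ 𝒜, MeasurableSet s) (k : ℕ) :
    ∀ h ∈ fam 𝒜 D k, Measurable h := by
  classical
  induction k with
  | zero => rintro _ ⟨y, _, rfl⟩; exact measurable_const
  | succ k ih =>
    rintro h (hh | ⟨⟨A, f, g⟩, ⟨hA, hf, hg⟩, rfl⟩)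
    · exact ih h hh
    · exact Measurable.piecewise (h𝒜 A hA) (ih f hf) (ih g hg)

omit [TopologicalSpace.SeparableSpace Y] [Nonempty Y] [BorelSpace Y] [MetricSpace Y]
  [MeasurableSpace X] [MeasurableSpace Y] in
lemma fam_mono (𝒜 : Set (Set X)) (D : Set Y) : Monotone (fam 𝒜 D) :=
  monotone_nat_of_le_succ fun _ => Set.subset_union_left

lemma exists_dense_family [MeasurableSpace.CountablyGenerated X] (ν : Measure X) [IsFiniteMeasure ν]
    {C : ℝ} (hbdd : ∀ y₁ y₂ : Y, dist y₁ y₂ ≤ C) :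
    ∃ h : ℕ → X → Y, (∀ i, Measurable (h i)) ∧
      ∀ f : X → Y, Measurable f → ∀ ε : ℝ, 0 < ε → ∃ i, ∫ x, dist (h i x) (f x) ∂ν ≤ ε := by
  classical
  obtain ⟨𝒜, h𝒜c, h𝒜⟩ := exists_countable_measureDense ν
  obtain ⟨D, hDc, hDd⟩ := TopologicalSpace.exists_countable_dense Y
  have hedist : ∀ y₁ y₂ : Y, edist y₁ y₂ ≤ ENNReal.ofReal C := fun y₁ y₂ => by
    rw [edist_dist]; exact ENNReal.ofReal_le_ofReal (hbdd _ _)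
  set H : Set (X → Y) := ⋃ k, fam 𝒜 D k with hH
  have hHc : H.Countable := Set.countable_iUnion fun k => fam_countable h𝒜c hDc k
  have hHm : ∀ h ∈ H, Measurable h := by
    intro h hh
    obtain ⟨k, hk⟩ := Set.mem_iUnion.1 hh
    exact fam_measurable h𝒜.measurable k h hk
  have hHp : ∀ A ∈ 𝒜, ∀ f ∈ H, ∀ g ∈ H, A.piecewise f g ∈ H := by
    intro A hA f hf g hg
    obtain ⟨k, hk⟩ := Set.mem_iUnion.1 hf
    obtain ⟨l, hl⟩ := Set.mem_iUnion.1 hg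
    refine Set.mem_iUnion.2 ⟨max k l + 1, Or.inr ⟨(A, f, g), ⟨hA, ?_, ?_⟩, rfl⟩⟩
    · exact fam_mono _ _ (le_max_left k l) hk
    · exact fam_mono _ _ (le_max_right k l) hl
  -- simple functions
  have hsimple : ∀ s : SimpleFunc X Y, ∀ ε : ℝ, 0 < ε → ∃ h ∈ H,
      ∫⁻ x, edist (h x) (s x) ∂ν ≤ ENNReal.ofReal ε := by
    intro s
    induction s using SimpleFunc.induction' with
    | const c =>
      intro ε hε
      set V := (ν Set.univ).toReal
      have hV : 0 ≤ V := ENNReal.toReal_nonneg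
      obtain ⟨y, hyD, hy⟩ := hDd.exists_dist_lt c (ε := ε / (V + 1)) (by positivity)
      refine ⟨fun _ => y, Set.mem_iUnion.2 ⟨0, y, hyD, rfl⟩, ?_⟩
      simp only [SimpleFunc.coe_const, Function.const_apply, lintegral_const]
      rw [edist_dist, dist_comm, ← ENNReal.ofReal_toReal (measure_ne_top ν Set.univ),
        ← ENNReal.ofReal_mul dist_nonneg]
      apply ENNReal.ofReal_le_ofReal
      calc dist c y * V ≤ ε / (V + 1) * V := by gcongr
        _ ≤ ε := by
          rw [div_mul_eq_mul_div, div_le_iff₀ (by positivity)]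
          nlinarith
    | pcw hs hf hg =>
      rename_i f g s
      intro ε hε
      obtain ⟨f', hf', hfe⟩ := hf (ε / 3) (by positivity)
      obtain ⟨g', hg', hge⟩ := hg (ε / 3) (by positivity)
      set K := max C 0
      have hK : 0 ≤ K := le_max_right _ _
      obtain ⟨A, hA, hAe⟩ := h𝒜.approx s hs (measure_ne_top _ _) (ε / 3 / (K + 1)) (by positivity)
      refine ⟨A.piecewise f' g', hHp A hA f' hf' g' hg', ?_⟩
      have hAm := h𝒜.measurable A hA
      have hle : ∀ x, edist (A.piecewise f' g' x) (f.piecewise s hs g x)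
          ≤ edist (f' x) (f x) + (edist (g' x) (g x)
            + (s ∆ A).indicator (fun _ => ENNReal.ofReal K) x) := by
        intro x
        rw [SimpleFunc.coe_piecewise]
        by_cases h1 : x ∈ A <;> by_cases h2 : x ∈ s
        · simp only [Set.piecewise_eq_of_mem _ _ _ h1, Set.piecewise_eq_of_mem _ _ _ h2]
          exact le_self_add
        · have h3 : x ∈ s ∆ A := Or.inr ⟨h1, h2⟩
          rw [Set.indicator_of_mem h3]
          refine le_add_left (le_add_left ?_)
          exact (hedist _ _).trans (ENNReal.ofReal_le_ofReal (le_max_left _ _))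
        · have h3 : x ∈ s ∆ A := Or.inl ⟨h2, h1⟩
          rw [Set.indicator_of_mem h3]
          refine le_add_left (le_add_left ?_)
          exact (hedist _ _).trans (ENNReal.ofReal_le_ofReal (le_max_left _ _))
        · simp only [Set.piecewise_eq_of_notMem _ _ _ h1, Set.piecewise_eq_of_notMem _ _ _ h2]
          exact le_add_left le_self_add
      have hmf : Measurable fun x => edist (f' x) (f x) := (hHm f' hf').edist f.measurable
      have hmg : Measurable fun x => edist (g' x) (g x) := (hHm g' hg').edist g.measurable
      calc ∫⁻ x, edist (A.piecewise f' g' x) (f.piecewise s hs g x) ∂ν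
          ≤ ∫⁻ x, edist (f' x) (f x) + (edist (g' x) (g x)
            + (s ∆ A).indicator (fun _ => ENNReal.ofReal K) x) ∂ν := lintegral_mono hle
        _ = ∫⁻ x, edist (f' x) (f x) ∂ν + (∫⁻ x, edist (g' x) (g x) ∂ν
            + ENNReal.ofReal K * ν (s ∆ A)) := by
          rw [lintegral_add_left hmf, lintegral_add_left hmg,
            lintegral_indicator (hs.symmDiff hAm), lintegral_const]
          simp
        _ ≤ ENNReal.ofReal (ε/3) + (ENNReal.ofReal (ε/3) + ENNReal.ofReal (ε/3)) := by
          gcongr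
          calc ENNReal.ofReal K * ν (s ∆ A)
              ≤ ENNReal.ofReal K * ENNReal.ofReal (ε / 3 / (K + 1)) := by gcongr
            _ = ENNReal.ofReal (K * (ε / 3 / (K + 1))) := by rw [ENNReal.ofReal_mul hK]
            _ ≤ ENNReal.ofReal (ε/3) := by
              apply ENNReal.ofReal_le_ofReal
              rw [mul_div_assoc', div_le_iff₀ (by positivity)]
              nlinarith
        _ = ENNReal.ofReal ε := by
          rw [← ENNReal.ofReal_add (by positivity) (by positivity),
            ← ENNReal.ofReal_add (by positivity) (by positivity)]
          congr 1; ring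
  have hHne : H.Nonempty := by
    obtain ⟨y, hy⟩ := hDd.nonempty
    exact ⟨fun _ => y, Set.mem_iUnion.2 ⟨0, y, hy, rfl⟩⟩
  obtain ⟨h, hh⟩ := hHc.exists_eq_range hHne
  have hi : ∀ i, h i ∈ H := fun i => hh ▸ Set.mem_range_self i
  refine ⟨h, fun i => hHm _ (hi i), fun f hf ε hε => ?_⟩
  let y₀ : Y := Classical.arbitrary Y
  let F : ℕ → SimpleFunc X Y := SimpleFunc.approxOn f hf Set.univ y₀ (Set.mem_univ _)
  have hF : ∀ x, Tendsto (fun n => F n x) atTop (𝓝 (f x)) := fun x =>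
    SimpleFunc.tendsto_approxOn hf (Set.mem_univ _) (by simp)
  have hlim : Tendsto (fun n => ∫⁻ x, edist (F n x) (f x) ∂ν) atTop (𝓝 (∫⁻ x, 0 ∂ν)) := by
    refine tendsto_lintegral_of_dominated_convergence (fun _ => ENNReal.ofReal C)
      (fun n => (F n).measurable.edist hf) (fun n => ae_of_all _ fun x => hedist _ _) ?_ ?_
    · rw [lintegral_const]; exact ENNReal.mul_ne_top ENNReal.ofReal_ne_top (measure_ne_top _ _)
    · exact ae_of_all _ fun x => by
        exact tendsto_iff_edist_tendsto_0.1 (hF x)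
  rw [lintegral_zero] at hlim
  obtain ⟨n, hn⟩ := (hlim.eventually_lt_const
    (show (0 : ℝ≥0∞) < ENNReal.ofReal (ε / 2) by simpa using hε)).exists
  obtain ⟨g, hgH, hg⟩ := hsimple (F n) (ε / 2) (by positivity)
  rw [hh] at hgH
  obtain ⟨i, rfl⟩ := hgH
  refine ⟨i, ?_⟩
  rw [integral_eq_lintegral_of_nonneg_ae (ae_of_all _ fun _ => dist_nonneg)
    ((hHm _ (hi i)).dist hf).aestronglyMeasurable]
  refine ENNReal.toReal_le_of_le_ofReal hε.le ?_
  simp only [← edist_dist]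
  calc ∫⁻ x, edist (h i x) (f x) ∂ν ≤ ∫⁻ x, edist (h i x) (F n x) + edist (F n x) (f x) ∂ν :=
        lintegral_mono fun x => edist_triangle _ _ _
    _ = ∫⁻ x, edist (h i x) (F n x) ∂ν + ∫⁻ x, edist (F n x) (f x) ∂ν :=
        lintegral_add_left ((hHm _ (hi i)).edist (F n).measurable) _
    _ ≤ ENNReal.ofReal (ε/2) + ENNReal.ofReal (ε/2) := add_le_add hg hn.le
    _ = ENNReal.ofReal ε := by
      rw [← ENNReal.ofReal_add (by positivity) (by positivity)]; congr 1; ring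

end

end NoOpt

namespace NoOpt

section
variable {X Y : Type*} [MeasurableSpace X] [MetricSpace Y]
  [TopologicalSpace.SeparableSpace Y] [Nonempty Y] [MeasurableSpace Y] [BorelSpace Y]

omit [TopologicalSpace.SeparableSpace Y] [Nonempty Y] [MeasurableSpace Y] [BorelSpace Y]
  [MeasurableSpace X] in
lemma indLoss_eq (f : ∀ n : ℕ, (Fin n → X) → (Fin n → Y) → X → Y)
    (fstar : X → Y) (n : ℕ) (x : ℕ → X) {L : ℝ}
    (h : Tendsto (avg fun s => dist (f n (fun i => x i.1) (fun i => fstar (x i.1)) (x s))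
      (fstar (x s))) atTop (𝓝 L)) : indLoss f fstar n x = L :=
  (avg_shift n h).limsup_eq

lemma suil_crit [MeasurableSpace.CountablyGenerated X] (μ : Measure (ℕ → X))
    (ν : Measure X) [IsFiniteMeasure ν]
    {C : ℝ} (hbdd : ∀ y₁ y₂ : Y, dist y₁ y₂ ≤ C)
    (Est : ℕ → (ℕ → ℝ) → ℝ) (hEm : ∀ m, Measurable (Est m)) (S : ℕ → ℕ)
    (hS : ∀ m (a b : ℕ → ℝ), (∀ s < S m, a s = b s) → Est m a = Est m b)
    (K : ℝ) (hK : 0 ≤ K)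
    (H1 : ∀ φ : X → ℝ, Measurable φ → (∀ x, 0 ≤ φ x) → (∀ x, φ x ≤ C) → ∀ m,
      ∫⁻ x, ENNReal.ofReal ((Est m (fun s => φ (x s)) - ∫ z, φ z ∂ν) ^ 2) ∂μ
        ≤ ENNReal.ofReal (K * (1 / 2) ^ m))
    (H2 : ∀ φ : X → ℝ, Measurable φ → (∀ x, 0 ≤ φ x) → (∀ x, φ x ≤ C) → 
      ∀ᵐ x ∂μ, ∃ L ≤ ∫ z, φ z ∂ν, Tendsto (avg fun s => φ (x s)) atTop (𝓝 L)) :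
    SUIL Y μ := by
  classical
  obtain ⟨h, hm, hd⟩ := exists_dense_family (Y := Y) ν hbdd
  let mm : ℕ → ℕ := fun n => Nat.findGreatest (fun m => S m ≤ n) n
  let E : ∀ n : ℕ, ((Fin n → X) × (Fin n → Y)) → ℕ → ℝ := fun n q i =>
    Est (mm n) (fun s => if hs : s < n then dist (h i (q.1 ⟨s, hs⟩)) (q.2 ⟨s, hs⟩) else 0)
  have hE : ∀ n i, Measurable (fun q => E n q i) := by
    intro n i
    refine (hEm (mm n)).comp (measurable_pi_lambda _ fun s => ?_)
    by_cases hs : s < n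
    · simp only [hs, dif_pos]
      exact ((hm i).comp ((measurable_pi_apply _).comp measurable_fst)).dist
        ((measurable_pi_apply _).comp measurable_snd)
    · simp only [hs, dif_neg, not_false_eq_true]; exact measurable_const
  have hex : ∀ n (q : (Fin n → X) × (Fin n → Y)), ∃ i, i ≤ mm n ∧ ∀ j ≤ mm n, E n q i ≤ E n q j := by
    intro n q
    obtain ⟨i, hi, hi2⟩ := Finset.exists_min_image (Finset.range (mm n + 1)) (E n q) ⟨0, by simp⟩
    exact ⟨i, by simpa [Nat.lt_succ_iff] using hi, fun j hj => hi2 j (by simpa [Nat.lt_succ_iff] using hj)⟩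
  let I : ∀ n : ℕ, ((Fin n → X) × (Fin n → Y)) → ℕ := fun n q => Nat.find (hex n q)
  have hI : ∀ n, Measurable (I n) := by
    intro n
    refine measurable_find (hex n) fun k => ?_
    refine MeasurableSet.inter (MeasurableSet.const _) ?_
    have : {q : (Fin n → X) × (Fin n → Y) | ∀ j ≤ mm n, E n q k ≤ E n q j}
        = ⋂ j, ⋂ (_ : j ≤ mm n), {q | E n q k ≤ E n q j} := by
      ext q; simp
    change MeasurableSet {q : (Fin n → X) × (Fin n → Y) | ∀ j ≤ mm n, E n q k ≤ E n q j}
    rw [this]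
    exact MeasurableSet.iInter fun j => MeasurableSet.iInter fun _ =>
      measurableSet_le (hE n k) (hE n j)
  let f : ∀ n : ℕ, (Fin n → X) → (Fin n → Y) → X → Y := fun n x y x' => h (I n (x, y)) x'
  refine ⟨f, ?_, ?_⟩
  · intro n
    have h1 : Measurable (fun r : ℕ × X => h r.1 r.2) :=
      measurable_from_prod_countable_right fun i => hm i
    have h2 : Measurable (fun p : (Fin n → X) × (Fin n → Y) × X => (I n (p.1, p.2.1), p.2.2)) :=
      ((hI n).comp (measurable_fst.prodMk (measurable_fst.comp measurable_snd))).prodMk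
        (measurable_snd.comp measurable_snd)
    exact h1.comp h2
  intro fstar hf
  let φ : ℕ → X → ℝ := fun i z => dist (h i z) (fstar z)
  have hφm : ∀ i, Measurable (φ i) := fun i => (hm i).dist hf
  have hφ0 : ∀ i z, 0 ≤ φ i z := fun i z => dist_nonneg
  have hφC : ∀ i z, φ i z ≤ C := fun i z => hbdd _ _
  have hEsm : ∀ m i, Measurable (fun x : ℕ → X => Est m (fun s => φ i (x s))) := fun m i =>
    (hEm m).comp (measurable_pi_lambda _ fun s => (hφm i).comp (measurable_pi_apply s))
  let d : ℕ → ℕ → (ℕ → X) → ℝ := fun m i x => Est m (fun s => φ i (x s)) - ∫ z, φ i z ∂ν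
  have hdm : ∀ m i, Measurable (d m i) := fun m i => (hEsm m i).sub_const _
  let e : ℕ → (ℕ → X) → ℝ := fun m x => Real.sqrt (∑ i ∈ Finset.range (m + 1), d m i x ^ 2)
  have hem : ∀ m, Measurable (e m) := fun m => by
    refine Measurable.sqrt ?_
    exact Finset.measurable_sum _ fun i _ => (hdm m i).pow_const 2
  have hsum : Summable (fun m : ℕ => ((m : ℝ) + 1) * (K * (1 / 2) ^ m)) := by
    have h1 : Summable (fun m : ℕ => (m : ℝ) ^ 1 * (1 / 2 : ℝ) ^ m) :=
      summable_pow_mul_geometric_of_norm_lt_one 1 (by norm_num)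
    have h2 : Summable (fun m : ℕ => (1 / 2 : ℝ) ^ m) := summable_geometric_two
    refine ((h1.add h2).mul_left K).congr fun m => ?_
    ring
  have hae1 : ∀ᵐ x ∂μ, Tendsto (fun m => e m x) atTop (𝓝 0) := by
    refine ae_tendsto_of_sq hem hsum (fun m => by positivity) fun m => ?_
    have h1 : ∀ x, e m x ^ 2 = ∑ i ∈ Finset.range (m + 1), d m i x ^ 2 := fun x =>
      Real.sq_sqrt (Finset.sum_nonneg fun _ _ => sq_nonneg _)
    simp only [h1]
    have h2 : ∀ x, ENNReal.ofReal (∑ i ∈ Finset.range (m + 1), d m i x ^ 2)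
        = ∑ i ∈ Finset.range (m + 1), ENNReal.ofReal (d m i x ^ 2) := fun x =>
      ENNReal.ofReal_sum_of_nonneg fun _ _ => sq_nonneg _
    simp only [h2]
    rw [lintegral_finsetSum _ fun i _ => ((hdm m i).pow_const 2).ennreal_ofReal]
    calc _ ≤ ∑ i ∈ Finset.range (m + 1), ENNReal.ofReal (K * (1 / 2) ^ m) :=
          Finset.sum_le_sum fun i _ => H1 (φ i) (hφm i) (hφ0 i) (hφC i) m
      _ = ENNReal.ofReal (((m : ℝ) + 1) * (K * (1 / 2) ^ m)) := by
        rw [Finset.sum_const, Finset.card_range, nsmul_eq_mul, ← Nat.cast_succ,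
          ENNReal.ofReal_mul (p := ((m.succ : ℕ) : ℝ)) (by positivity), ENNReal.ofReal_natCast]
  have hae2 : ∀ᵐ x ∂μ, ∀ i, ∃ L ≤ ∫ z, φ i z ∂ν, Tendsto (avg fun s => φ i (x s)) atTop (𝓝 L) :=
    ae_all_iff.2 fun i => H2 (φ i) (hφm i) (hφ0 i) (hφC i)
  filter_upwards [hae1, hae2] with x hx1 hx2
  choose L hL hLt using hx2
  have hloss : ∀ n, indLoss f fstar n x
      = L (I n ((fun i => x i.1), (fun i => fstar (x i.1)))) := fun n =>
    indLoss_eq f fstar n x (hLt _)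
  have hL0 : ∀ i, 0 ≤ L i := fun i => ge_of_tendsto' (hLt i) fun t =>
    div_nonneg (Finset.sum_nonneg fun _ _ => hφ0 _ _) (by positivity)
  simp only [hloss]
  rw [Metric.tendsto_atTop]
  intro ε hε
  obtain ⟨i0, hi0⟩ := hd fstar hf (ε / 4) (by positivity)
  obtain ⟨M, hM⟩ := Metric.tendsto_atTop.1 hx1 (ε / 4) (by positivity)
  set m1 := max i0 M
  refine ⟨max m1 (S m1), fun n hn => ?_⟩
  have hn1 : m1 ≤ n := le_trans (le_max_left _ _) hn
  have hn2 : S m1 ≤ n := le_trans (le_max_right _ _) hn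
  have hmm : m1 ≤ mm n := Nat.le_findGreatest hn1 hn2
  have hSm : S (mm n) ≤ n := Nat.findGreatest_spec (P := fun m => S m ≤ n) hn1 hn2
  have hEe : ∀ i, E n ((fun i => x i.1), (fun i => fstar (x i.1))) i
      = Est (mm n) (fun s => φ i (x s)) := fun i => by
    apply hS
    intro s hs
    simp only [show s < n by omega, dif_pos, φ]
  have hem' : e (mm n) x < ε / 4 := by
    have := hM (mm n) ((le_max_right _ _).trans hmm)
    rw [Real.dist_eq, sub_zero] at this
    exact (le_abs_self _).trans_lt this
  have hde : ∀ i ≤ mm n, |d (mm n) i x| ≤ e (mm n) x := fun i hi => by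
    refine Real.abs_le_sqrt ?_
    exact Finset.single_le_sum (f := fun i => d (mm n) i x ^ 2) (fun _ _ => sq_nonneg _)
      (Finset.mem_range.2 (by omega))
  obtain ⟨hs1, hs2⟩ := Nat.find_spec (hex n ((fun i => x i.1), (fun i => fstar (x i.1))))
  set J := I n ((fun i => x i.1), (fun i => fstar (x i.1))) with hJ
  have hi0m : i0 ≤ mm n := (le_max_left _ _).trans hmm
  have a1 := hs2 i0 hi0m
  have a2 : E n ((fun i => x i.1), (fun i => fstar (x i.1))) J
    ≤ E n ((fun i => x i.1), (fun i => fstar (x i.1))) i0 := a1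
  rw [hEe, hEe] at a2
  have a3 := (abs_le.1 (hde J hs1)).1
  have a4 := (abs_le.1 (hde i0 hi0m)).2
  simp only [d] at a3 a4
  have a5 : ∫ z, φ i0 z ∂ν ≤ ε / 4 := hi0
  rw [Real.dist_eq, sub_zero, abs_of_nonneg (hL0 _)]
  have a6 := hL J
  linarith

end

end NoOpt

namespace NoOpt

section
variable {X ι : Type*} [MeasurableSpace X] (π : Measure X) [IsProbabilityMeasure π]

lemma measurable_int_section {Ω : Type*} [MeasurableSpace Ω] {F : Ω → X → ℝ}
    (hF : Measurable fun p : Ω × X => F p.1 p.2) : Measurable fun ω => ∫ x, F ω x ∂π :=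
  (StronglyMeasurable.integral_prod_right (f := fun ω x => F ω x)
    (show StronglyMeasurable (Function.uncurry F) from hF.stronglyMeasurable)).measurable

lemma measurable_ev {F : (ι → X) → X → ℝ}
    (hF : Measurable fun p : (ι → X) × X => F p.1 p.2) (e : ℕ → ι) (M : ℕ) :
    Measurable fun ω : ι → X => avg (fun q => F ω (ω (e q))) M := by
  unfold avg
  refine Measurable.div_const ?_ _
  refine Finset.measurable_sum _ fun q _ => ?_
  exact hF.comp (measurable_id.prodMk (measurable_pi_apply (e q)))

variable {F : (ι → X) → X → ℝ} (hF : Measurable fun p : (ι → X) × X => F p.1 p.2)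
  {C : ℝ} (h0 : ∀ ω x, 0 ≤ F ω x) (hC : ∀ ω x, F ω x ≤ C) (S : Set ι)
  (hS : ∀ a b : ι → X, (∀ i ∈ S, a i = b i) → F a = F b)

include hF h0 hC hS in
lemma hist_slln {e : ℕ → ι} (he : Function.Injective e) (hes : ∀ᶠ q in atTop, e q ∉ S) :
    ∀ᵐ ω ∂(iid π ι), Tendsto (avg (fun q => F ω (ω (e q)))) atTop (𝓝 (∫ x, F ω x ∂π)) := by
  refine merge_ae π S (R := {ω | Tendsto (avg (fun q => F ω (ω (e q)))) atTop
    (𝓝 (∫ x, F ω x ∂π))}) ?_ ?_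
  · exact measurableSet_tendsto_fun (fun M => measurable_ev hF e M) (measurable_int_section π hF)
  · intro a
    have hm : Measurable (F a) := hF.comp measurable_prodMk_left
    filter_upwards [iid_slln π hm (h0 a) (hC a) he] with b hb
    have h1 : F (merge S a b) = F a := hS _ _ fun i hi => by simp [merge, hi]
    change Tendsto (avg (fun q => F (merge S a b) (merge S a b (e q)))) atTop
      (𝓝 (∫ x, F (merge S a b) x ∂π))
    rw [h1]
    refine avg_congr_ev ?_ hb
    filter_upwards [hes] with q hq
    simp [merge, hq]

include hF h0 hC hS in
lemma hist_tri {e : ℕ → ℕ → ι} (he : ∀ j, Function.Injective (e j))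
    (hes : ∀ᶠ j in atTop, ∀ i, e j i ∉ S) :
    ∀ᵐ ω ∂(iid π ι), Tendsto (fun j => avg (fun q => F ω (ω (e j q))) (2 ^ j)) atTop
      (𝓝 (∫ x, F ω x ∂π)) := by
  refine merge_ae π S (R := {ω | Tendsto (fun j => avg (fun q => F ω (ω (e j q))) (2 ^ j)) atTop
    (𝓝 (∫ x, F ω x ∂π))}) ?_ ?_
  · exact measurableSet_tendsto_fun (fun M => measurable_ev hF (e M) _)
      (measurable_int_section π hF)
  · intro a
    have hm : Measurable (F a) := hF.comp measurable_prodMk_left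
    have key : ∀ᵐ b ∂(iid π ι), Tendsto (fun j => avg (fun q => F a (b (e j q))) (2 ^ j)
        - ∫ x, F a x ∂π) atTop (𝓝 0) := by
      refine ae_tendsto_of_sq (r := fun j => C ^ 2 * (1 / 2) ^ j)
        (fun j => (measurable_ev (F := fun _ x => F a x) (hm.comp measurable_snd) (e j) _).sub_const _)
        (summable_geometric_two.mul_left _) (fun j => by positivity) fun j => ?_
      refine (iid_var π hm (h0 a) (hC a) (he j) (M := 2 ^ j) (by positivity)).trans (le_of_eq ?_)
      congr 1
      push_cast
      rw [one_div, inv_pow]; rfl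
    filter_upwards [key] with b hb
    have h1 : F (merge S a b) = F a := hS _ _ fun i hi => by simp [merge, hi]
    change Tendsto (fun j => avg (fun q => F (merge S a b) (merge S a b (e j q))) (2 ^ j)) atTop
      (𝓝 (∫ x, F (merge S a b) x ∂π))
    rw [h1]
    have hb2 := (tendsto_sub_nhds_zero_iff).1 hb
    refine hb2.congr' ?_
    filter_upwards [hes] with j hj
    congr 1
    funext q
    simp [merge, hj q]

end

section
variable {X : Type*}

/-- the process -/
def Xp (κ : ℕ → ℕ) (u : ℕ × ℕ → X) (g : ℕ → X) (t : ℕ) : X :=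
  if 2 ^ κ t ∣ t then g t else u (κ t, t % 2 ^ κ t)

lemma alt_det {κ : ℕ → ℕ} {u : ℕ × ℕ → X} {g : ℕ → X} {k T : ℕ} (hκ : ∀ t, T ≤ t → κ t = k)
    {φ : X → ℝ} {C : ℝ} (h0 : ∀ x, 0 ≤ φ x) (hC : ∀ x, φ x ≤ C) {L0 : ℝ}
    (h : Tendsto (avg fun m => φ (g (2 ^ k * m))) atTop (𝓝 L0)) :
    Tendsto (avg fun s => φ (Xp κ u g s)) atTop
      (𝓝 ((∑ i ∈ Finset.range (2 ^ k), if i = 0 then L0 else φ (u (k, i))) / ((2 ^ k : ℕ) : ℝ))) := by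
  have hp : 0 < 2 ^ k := by positivity
  refine avg_res (fun s => h0 _) (fun s => hC _) hp fun i hi => ?_
  have hT : ∀ m, T ≤ m → κ (2 ^ k * m + i) = k := fun m hm => hκ _ (by nlinarith)
  by_cases hi0 : i = 0
  · subst hi0
    simp only [if_true]
    refine avg_congr_ev ?_ h
    filter_upwards [eventually_ge_atTop T] with m hm
    have := hT m hm
    simp only [add_zero] at this
    simp [Xp, this]
  · simp only [hi0, if_false]
    refine avg_of_ev_const ?_
    filter_upwards [eventually_ge_atTop T] with m hm
    have h1 : ¬ 2 ^ k ∣ 2 ^ k * m + i := fun hd => by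
      have := (Nat.dvd_add_right (Dvd.intro m rfl)).1 hd
      exact absurd (Nat.le_of_dvd (by omega) this) (by omega)
    simp only [Xp, hT m hm, h1, if_false, Nat.mul_add_mod, Nat.mod_eq_of_lt hi]

end

end NoOpt

namespace NoOpt

section
variable {X Y : Type*} [MeasurableSpace X] [MetricSpace Y]
  [TopologicalSpace.SeparableSpace Y] [Nonempty Y] [MeasurableSpace Y] [BorelSpace Y]
  [MeasurableSpace.CountablyGenerated X]
  (π : Measure X) [IsProbabilityMeasure π]

omit [MeasurableSpace.CountablyGenerated X] in
lemma measurable_Xp (κ : ℕ → ℕ) :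
    Measurable fun p : (ℕ × ℕ → X) × (ℕ → X) => Xp κ p.1 p.2 := by
  refine measurable_pi_lambda _ fun t => ?_
  unfold Xp
  by_cases h : 2 ^ κ t ∣ t
  · simp only [h, if_true]; fun_prop
  · simp only [h, if_false]; fun_prop

lemma alt_suil {C : ℝ} (hbdd : ∀ y₁ y₂ : Y, dist y₁ y₂ ≤ C) {κ : ℕ → ℕ} (u : ℕ × ℕ → X)
    {k T : ℕ} (hκ : ∀ t, T ≤ t → κ t = k) :
    SUIL Y ((iid π ℕ).map (fun g => Xp κ u g)) := by
  set p := 2 ^ k with hp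
  have hp0 : 0 < p := by positivity
  have hXm : Measurable (fun g : ℕ → X => Xp κ u g) :=
    (measurable_Xp κ).comp measurable_prodMk_left
  let E := (Finset.range p).erase 0
  let ν : Measure X := π + ∑ i ∈ E, Measure.dirac (u (k, i))
  have hν : ∀ φ : X → ℝ, Measurable φ → (∀ x, 0 ≤ φ x) → (∀ x, φ x ≤ C) →
      ∫ z, φ z ∂ν = ∫ z, φ z ∂π + ∑ i ∈ E, φ (u (k, i)) := by
    intro φ hφ h0 hC
    rw [integral_add_measure (integrable_bdd hφ h0 hC) (integrable_bdd hφ h0 hC),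
      integral_finsetSum_measure (fun i _ => integrable_bdd hφ h0 hC)]
    congr 1
    exact Finset.sum_congr rfl fun i _ => integral_dirac' _ _ hφ.stronglyMeasurable
  have hTp : ∀ a, T ≤ p * (T + a) := fun a => by nlinarith
  have hx0 : ∀ g q, Xp κ u g (p * (T + q)) = g (p * (T + q)) := fun g q => by
    unfold Xp
    rw [hκ _ (hTp q), if_pos (Dvd.intro _ rfl)]
  have hx1 : ∀ g, ∀ i ∈ E, Xp κ u g (p * T + i) = u (k, i) := fun g i hi => by
    have hi1 : i ≠ 0 := (Finset.mem_erase.1 hi).1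
    have hi2 : i < p := Finset.mem_range.1 (Finset.mem_erase.1 hi).2
    have h1 : ¬ p ∣ p * T + i := fun hd => by
      have := (Nat.dvd_add_right (Dvd.intro T rfl)).1 hd
      exact absurd (Nat.le_of_dvd (by omega) this) (by omega)
    have h2 : κ (p * T + i) = k := hκ _ (by nlinarith)
    simp only [Xp, h2, ← hp, h1, if_false, Nat.mul_add_mod, Nat.mod_eq_of_lt hi2]
  refine suil_crit (C := C) _ ν hbdd
    (fun m a => avg (fun q => a (p * (T + q))) (2 ^ m) + ∑ i ∈ E, a (p * T + i))
    (fun m => by unfold avg; fun_prop) (fun m => p * (T + 2 ^ m + 1)) ?_ (C ^ 2) (sq_nonneg _) ?_ ?_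
  · intro m a b hab
    have e1 : avg (fun q => a (p * (T + q))) (2 ^ m) = avg (fun q => b (p * (T + q))) (2 ^ m) := by
      unfold avg
      congr 1
      refine Finset.sum_congr rfl fun q hq => hab _ ?_
      have := Finset.mem_range.1 hq
      exact Nat.mul_lt_mul_of_pos_left (by omega) hp0
    have e2 : ∑ i ∈ E, a (p * T + i) = ∑ i ∈ E, b (p * T + i) := by
      refine Finset.sum_congr rfl fun i hi => hab _ ?_
      have hi2 : i < p := Finset.mem_range.1 (Finset.mem_erase.1 hi).2
      nlinarith [Nat.zero_le (2 ^ m)]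
    change avg (fun q => a (p * (T + q))) (2 ^ m) + _ = avg (fun q => b (p * (T + q))) (2 ^ m) + _
    rw [e1, e2]
  · intro φ hφ h0 hC m
    rw [hν φ hφ h0 hC, lintegral_map _ hXm]
    · have : ∀ g : ℕ → X, avg (fun q => φ (Xp κ u g (p * (T + q)))) (2 ^ m)
          + ∑ i ∈ E, φ (Xp κ u g (p * T + i)) - (∫ z, φ z ∂π + ∑ i ∈ E, φ (u (k, i)))
          = avg (fun q => φ (g (p * (T + q)))) (2 ^ m) - ∫ z, φ z ∂π := fun g => by
        rw [Finset.sum_congr rfl fun i hi => by rw [hx1 g i hi]]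
        simp only [hx0]
        ring
      simp only [this]
      refine (iid_var π hφ h0 hC (e := fun q => p * (T + q)) ?_ (M := 2 ^ m)
        (by positivity)).trans (le_of_eq ?_)
      · intro a b hab
        have := Nat.eq_of_mul_eq_mul_left hp0 hab
        omega
      · congr 1
        push_cast
        rw [one_div, inv_pow]; rfl
    · unfold avg; fun_prop
  · intro φ hφ h0 hC
    rw [hν φ hφ h0 hC]
    have hm : ∀ᵐ g ∂(iid π ℕ), Tendsto (avg fun s => φ (Xp κ u g s)) atTop
      (𝓝 ((∑ i ∈ Finset.range p, if i = 0 then ∫ z, φ z ∂π else φ (u (k, i))) / ((p : ℕ) : ℝ))) := by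
      filter_upwards [iid_slln π hφ h0 hC (e := fun q => p * q)
        (fun a b hab => Nat.eq_of_mul_eq_mul_left hp0 hab)] with g hg
      exact alt_det hκ h0 hC hg
    have hs : (∑ i ∈ Finset.range p, if i = 0 then ∫ z, φ z ∂π else φ (u (k, i)))
        = ∫ z, φ z ∂π + ∑ i ∈ E, φ (u (k, i)) := by
      rw [← Finset.add_sum_erase _ _ (Finset.mem_range.2 hp0)]
      simp only [if_true]
      congr 1
      exact Finset.sum_congr rfl fun i hi => by rw [if_neg (Finset.mem_erase.1 hi).1]
    rw [hs] at hm
    have hm2 : ∀ᵐ x ∂((iid π ℕ).map (fun g => Xp κ u g)), Tendsto (avg fun s => φ (x s)) atTop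
      (𝓝 ((∫ z, φ z ∂π + ∑ i ∈ E, φ (u (k, i))) / ((p : ℕ) : ℝ))) := by
      refine (ae_map_iff hXm.aemeasurable ?_).2 hm
      refine measurableSet_tendsto_fun (fun M => ?_) measurable_const
      unfold avg; fun_prop
    filter_upwards [hm2] with x hx
    refine ⟨_, ?_, hx⟩
    refine div_le_self ?_ (by exact_mod_cast hp0)
    exact add_nonneg (integral_nonneg h0) (Finset.sum_nonneg fun _ _ => h0 _)

end

end NoOpt

namespace NoOpt

section
variable {X Y : Type*} [MeasurableSpace X] [MetricSpace Y]
  [TopologicalSpace.SeparableSpace Y] [Nonempty Y] [MeasurableSpace Y] [BorelSpace Y]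
  [MeasurableSpace.CountablyGenerated X] [MeasurableSingletonClass X]
  (π : Measure X) [IsProbabilityMeasure π]

/-- labels -/
def lab (y0 y1 : Y) (κ : ℕ → ℕ) (s : ℕ) : Y := if 2 ^ κ s ∣ s then y1 else y0

/-- pointwise loss -/
def ls (f : ∀ n : ℕ, (Fin n → X) → (Fin n → Y) → X → Y) (y0 y1 y : Y) (κ : ℕ → ℕ) (n : ℕ)
    (p : (ℕ × ℕ → X) × (ℕ → X)) (x : X) : ℝ :=
  dist (f n (fun i => Xp κ p.1 p.2 i.1) (fun i => lab y0 y1 κ i.1) x) y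

/-- expected loss -/
noncomputable def D (f : ∀ n : ℕ, (Fin n → X) → (Fin n → Y) → X → Y) (y0 y1 : Y)
    (κ : ℕ → ℕ) (n : ℕ) (p : (ℕ × ℕ → X) × (ℕ → X)) : ℝ :=
  ∫ x, ls f y0 y1 y1 κ n p x ∂π

variable {f : ∀ n : ℕ, (Fin n → X) → (Fin n → Y) → X → Y} (hf : IsInductiveRule f)

include hf in
omit [Nonempty Y] [MeasurableSpace.CountablyGenerated X] [MeasurableSingletonClass X] in
lemma measurable_ls (y0 y1 y : Y) (κ : ℕ → ℕ) (n : ℕ) :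
    Measurable fun q : ((ℕ × ℕ → X) × (ℕ → X)) × X => ls f y0 y1 y κ n q.1 q.2 := by
  unfold ls
  have h2 : Measurable fun q : ((ℕ × ℕ → X) × (ℕ → X)) × X =>
      ((fun i : Fin n => Xp κ q.1.1 q.1.2 i.1), (fun i : Fin n => lab y0 y1 κ i.1), q.2) := by
    refine Measurable.prodMk (measurable_pi_lambda _ fun i => ?_)
      (measurable_const.prodMk measurable_snd)
    exact (measurable_pi_apply i.1).comp ((measurable_Xp κ).comp measurable_fst)
  exact ((hf n).comp h2).dist measurable_const

include hf in
omit [Nonempty Y] [MeasurableSpace.CountablyGenerated X] [MeasurableSingletonClass X] in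
lemma measurable_D (y0 y1 : Y) (κ : ℕ → ℕ) (n : ℕ) :
    Measurable (D π f y0 y1 κ n) :=
  measurable_int_section π (measurable_ls hf y0 y1 y1 κ n)

include hf in
lemma D_alt [NullSingletonClass π] {C : ℝ} (hbdd : ∀ y₁ y₂ : Y, dist y₁ y₂ ≤ C)
    (hcons : ∀ μ : Measure (ℕ → X), IsProbabilityMeasure μ → SUIL Y μ → StronglyConsistentInd μ f)
    (y0 y1 : Y) {κ : ℕ → ℕ} {k T : ℕ} (hκ : ∀ t, T ≤ t → κ t = k) (u : ℕ × ℕ → X) :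
    ∀ᵐ g ∂(iid π ℕ), Tendsto (fun n => D π f y0 y1 κ n (u, g)) atTop (𝓝 0) := by
  classical
  have hXm : Measurable (fun g : ℕ → X => Xp κ u g) :=
    (measurable_Xp κ).comp measurable_prodMk_left
  have hc := hcons ((iid π ℕ).map (fun g => Xp κ u g))
    (Measure.isProbabilityMeasure_map hXm.aemeasurable) (alt_suil π hbdd u hκ)
  let fstar : X → Y := fun x => if x ∈ Set.range u then y0 else y1
  have hfs : Measurable fstar := Measurable.ite (Set.countable_range u).measurableSet
    measurable_const measurable_const
  have h1 := ae_of_ae_map hXm.aemeasurable (hc fstar hfs)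
  have h2 : ∀ᵐ g ∂(iid π ℕ), ∀ n, Tendsto (avg (fun q => ls f y0 y1 y1 κ n (u, g) (g (2 ^ k * q))))
      atTop (𝓝 (D π f y0 y1 κ n (u, g))) := by
    rw [ae_all_iff]
    intro n
    refine hist_slln π (F := fun g x => ls f y0 y1 y1 κ n (u, g) x) ?_
      (fun _ _ => dist_nonneg) (fun _ _ => hbdd _ _) {s | s < n} ?_ (e := fun q => 2 ^ k * q)
      (fun a b hab => Nat.eq_of_mul_eq_mul_left (by positivity) hab) ?_
    · have hm : Measurable fun p : (ℕ → X) × X => (((u, p.1), p.2) : ((ℕ × ℕ → X) × (ℕ → X)) × X) :=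
        (measurable_const.prodMk measurable_fst).prodMk measurable_snd
      exact (measurable_ls hf y0 y1 y1 κ n).comp hm
    · intro a b hab
      funext x
      have : (fun i : Fin n => Xp κ u a i.1) = (fun i : Fin n => Xp κ u b i.1) := by
        funext i
        unfold Xp
        rw [hab i.1 i.2]
      simp only [ls, this]
    · filter_upwards [eventually_ge_atTop n] with q hq
      have : 1 ≤ 2 ^ k := Nat.one_le_two_pow
      change ¬ (2 ^ k * q < n)
      nlinarith
  filter_upwards [h1, h2, iid_notMem (ι := ℕ) π (Set.countable_range u)] with g g1 g2 g3
  have hlab : ∀ s, fstar (Xp κ u g s) = lab y0 y1 κ s := fun s => by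
    by_cases hd : 2 ^ κ s ∣ s
    · simp only [fstar, Xp, lab, if_pos hd, if_neg (g3 s)]
    · simp only [fstar, Xp, lab, if_neg hd, if_pos (Set.mem_range_self _)]
  have hge : ∀ n, D π f y0 y1 κ n (u, g) ≤ (2 ^ k : ℕ) * indLoss f fstar n (Xp κ u g) := fun n => by
    let φ : X → ℝ := fun x =>
      dist (f n (fun i => Xp κ u g i.1) (fun i => lab y0 y1 κ i.1) x) (fstar x)
    have hφ : Tendsto (avg fun m => φ (g (2 ^ k * m))) atTop (𝓝 (D π f y0 y1 κ n (u, g))) := by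
      refine (g2 n).congr' (Eventually.of_forall fun t => ?_)
      congr 1
      funext q
      simp only [φ, ls, fstar, if_neg (g3 _)]
    have h3 := alt_det (u := u) hκ (φ := φ) (C := C) (fun _ => dist_nonneg) (fun _ => hbdd _ _) hφ
    have h4 : indLoss f fstar n (Xp κ u g) = _ := indLoss_eq f fstar n (Xp κ u g) (L := _) (by
      simp only [hlab]
      refine h3.congr' (Eventually.of_forall fun t => ?_)
      congr 1
      funext s
      simp only [φ, hlab])
    rw [h4, mul_div_cancel₀ _ (by positivity)]
    have := Finset.single_le_sum
      (f := fun i => if i = 0 then D π f y0 y1 κ n (u, g) else φ (u (k, i)))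
      (s := Finset.range (2 ^ k)) (fun i _ => by
        split_ifs
        · exact integral_nonneg fun _ => dist_nonneg
        · exact dist_nonneg) (Finset.mem_range.2 (show 0 < 2 ^ k by positivity))
    simpa using this
  refine squeeze_zero (fun n => integral_nonneg fun _ => dist_nonneg) hge ?_
  simpa using g1.const_mul ((2 ^ k : ℕ) : ℝ)

include hf in
lemma D_step [NullSingletonClass π] {C : ℝ} (hbdd : ∀ y₁ y₂ : Y, dist y₁ y₂ ≤ C)
    (hcons : ∀ μ : Measure (ℕ → X), IsProbabilityMeasure μ → SUIL Y μ → StronglyConsistentInd μ f)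
    (y0 y1 : Y) {d : ℝ} (hd : 0 < d) {κ : ℕ → ℕ} {k T : ℕ} (hκ : ∀ t, T ≤ t → κ t = k) :
    ∃ n, T + 4 ^ (k + 1) ≤ n ∧ 4 ^ (k + 1) ∣ n ∧
      ((iid π (ℕ × ℕ)).prod (iid π ℕ)) {p | d < D π f y0 y1 κ n p} ≤ (1 / 2) ^ k := by
  have hm : MeasurableSet {p : (ℕ × ℕ → X) × (ℕ → X) |
      Tendsto (fun n => D π f y0 y1 κ n p) atTop (𝓝 0)} :=
    measurableSet_tendsto_fun (fun n => measurable_D π hf y0 y1 κ n) measurable_const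
  have hae : ∀ᵐ p ∂((iid π (ℕ × ℕ)).prod (iid π ℕ)),
      Tendsto (fun n => D π f y0 y1 κ n p) atTop (𝓝 0) := by
    rw [Measure.ae_prod_iff_ae_ae hm]
    exact ae_of_all _ fun u => D_alt π hf hbdd hcons y0 y1 hκ u
  have htm := tendstoInMeasure_of_tendsto_ae
    (fun n => (measurable_D π hf y0 y1 κ n).aestronglyMeasurable) hae
  have h1 := htm (ENNReal.ofReal d) (by simpa using hd)
  have h2 : ∀ᶠ n in atTop, ((iid π (ℕ × ℕ)).prod (iid π ℕ)) {p | d < D π f y0 y1 κ n p}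
      ≤ (1 / 2) ^ k := by
    have h3 : (0 : ENNReal) < (1 / 2) ^ k := by
      apply ENNReal.pow_pos; simp
    filter_upwards [h1.eventually (ge_mem_nhds h3)] with n hn
    refine (measure_mono fun p hp => ?_).trans hn
    change d < _ at hp
    change ENNReal.ofReal d ≤ edist _ _
    rw [edist_dist]
    apply ENNReal.ofReal_le_ofReal
    rw [Real.dist_eq, sub_zero]
    exact hp.le.trans (le_abs_self _)
  obtain ⟨N, hN⟩ := eventually_atTop.1 h2
  have hp : 1 ≤ 4 ^ (k + 1) := Nat.one_le_pow _ _ (by norm_num)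
  refine ⟨4 ^ (k + 1) * (N + T + 1), ?_, Dvd.intro _ rfl, hN _ ?_⟩ <;> nlinarith

end

end NoOpt

namespace NoOpt

lemma schedule {Pr : (ℕ → ℕ) → ℕ → ℕ → Prop}
    (hloc : ∀ κ κ' k n, (∀ t < n, κ t = κ' t) → Pr κ k n → Pr κ' k n)
    (hstep : ∀ κ k T, (∀ t, T ≤ t → κ t = k) →
      ∃ n, T + 4 ^ (k + 1) ≤ n ∧ 4 ^ (k + 1) ∣ n ∧ Pr κ k n) :
    ∃ (κ N : ℕ → ℕ), Monotone κ ∧ Tendsto κ atTop atTop ∧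
      (∀ t, κ (t+1) ≠ κ t → 2 ^ κ t ∣ t + 1 ∧ 2 ^ κ (t+1) ∣ t + 1) ∧
      (∀ t, 1 ≤ t → 4 ^ κ t ≤ t) ∧
      (∀ m, ∃ T, 2 ^ (m + 1) ∣ T ∧ ∀ i < 2 ^ (m + 1), κ (T + i) = m + 1) ∧
      Tendsto N atTop atTop ∧ ∀ k, Pr κ k (N k) := by
  classical
  choose nx hn1 hn2 hn3 using hstep
  let seq : (k : ℕ) → {q : (ℕ → ℕ) × ℕ // ∀ t, q.2 ≤ t → q.1 t = k} := fun k =>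
    Nat.rec (motive := fun k => {q : (ℕ → ℕ) × ℕ // ∀ t, q.2 ≤ t → q.1 t = k})
      ⟨(fun _ => 0, 0), fun _ _ => rfl⟩
      (fun k q => ⟨(fun t => if t < nx q.1.1 k q.1.2 q.2 then q.1.1 t else k + 1,
        nx q.1.1 k q.1.2 q.2), fun t ht => by
          change (if t < nx q.1.1 k q.1.2 q.2 then q.1.1 t else k + 1) = k + 1
          exact if_neg (not_lt.2 ht)⟩) k
  let T : ℕ → ℕ := fun k => (seq k).1.2
  have T0 : T 0 = 0 := rfl
  have T1 : ∀ k, T k + 4 ^ (k + 1) ≤ T (k + 1) := fun k => hn1 _ k _ (seq k).2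
  have T2 : ∀ k, 4 ^ (k + 1) ∣ T (k + 1) := fun k => hn2 _ k _ (seq k).2
  have T3 : ∀ k, Pr (seq k).1.1 k (T (k + 1)) := fun k => hn3 _ k _ (seq k).2
  have T4 : ∀ k t, (seq (k + 1)).1.1 t = if t < T (k + 1) then (seq k).1.1 t else k + 1 :=
    fun k t => rfl
  have hsm : StrictMono T := strictMono_nat_of_lt_succ fun k => by
    have := T1 k
    have : 0 < 4 ^ (k + 1) := by positivity
    omega
  have hid : ∀ k, k ≤ T k := hsm.id_le
  let κ : ℕ → ℕ := fun t => Nat.findGreatest (fun k => T k ≤ t) t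
  have s1 : ∀ t, T (κ t) ≤ t := fun t =>
    Nat.findGreatest_spec (P := fun k => T k ≤ t) (Nat.zero_le t) (by simp [T0])
  have s3 : ∀ k t, T k ≤ t → k ≤ κ t := fun k t h =>
    Nat.le_findGreatest ((hid k).trans h) h
  have s2 : ∀ t, t < T (κ t + 1) := fun t => by
    by_contra h
    have := s3 _ _ (not_lt.1 h)
    omega
  have s4 : ∀ k t, T k ≤ t → t < T (k + 1) → κ t = k := fun k t h1 h2 => by
    refine le_antisymm ?_ (s3 _ _ h1)
    by_contra h
    have h3 : T (k + 1) ≤ T (κ t) := hsm.monotone (by omega)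
    have := s1 t
    omega
  have s5 : ∀ k t, t < T (k + 1) → (seq k).1.1 t = κ t := by
    intro k
    induction k with
    | zero =>
      intro t ht
      rw [s4 0 t (by simp [T0]) ht]
      rfl
    | succ k ih =>
      intro t ht
      rw [T4]
      split_ifs with h
      · exact ih t h
      · exact (s4 _ _ (not_lt.1 h) ht).symm
  refine ⟨κ, fun k => T (k + 1), ?_, ?_, ?_, ?_, ?_, ?_, ?_⟩
  · intro s t hst
    exact s3 _ _ ((s1 s).trans hst)
  · exact tendsto_atTop.2 fun k => (eventually_ge_atTop (T k)).mono fun t ht => s3 _ _ ht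
  · intro t ht
    have h1 : t + 1 = T (κ t + 1) := by
      by_contra h
      apply ht
      have a := s1 t
      have b := s2 t
      exact s4 _ _ (by omega) (by omega)
    have h2 : κ (t + 1) = κ t + 1 := by
      refine s4 _ _ h1.ge ?_
      rw [h1]; exact hsm (by omega)
    have h3 : 2 ^ (κ t + 1) ∣ t + 1 := by
      rw [h1]
      exact (pow_dvd_pow_of_dvd (by norm_num : 2 ∣ 4) _).trans (T2 _)
    rw [h2]
    exact ⟨(pow_dvd_pow 2 (by omega)).trans h3, h3⟩
  · intro t ht
    rcases Nat.eq_zero_or_pos (κ t) with h | h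
    · rw [h]; simpa using ht
    · obtain ⟨k, hk⟩ : ∃ k, κ t = k + 1 := ⟨κ t - 1, by omega⟩
      have := s1 t
      have := T1 k
      rw [hk] at *
      omega
  · intro m
    refine ⟨T (m + 1), (pow_dvd_pow_of_dvd (by norm_num : 2 ∣ 4) _).trans (T2 _), fun i hi => ?_⟩
    refine s4 _ _ (by omega) ?_
    have h1 := T1 (m + 1)
    have h2 : 2 ^ (m + 1) ≤ 4 ^ (m + 1) := Nat.pow_le_pow_left (by norm_num) _
    have h3 : 4 ^ (m + 1) ≤ 4 ^ (m + 1 + 1) := Nat.pow_le_pow_right (by norm_num) (by omega)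
    omega
  · exact hsm.tendsto_atTop.comp (tendsto_add_atTop_nat 1)
  · intro k
    exact hloc _ _ _ _ (s5 k) (T3 k)

end NoOpt

namespace NoOpt

lemma main_det {X : Type*} {κ : ℕ → ℕ}
    (hj : ∀ t, κ (t+1) ≠ κ t → 2 ^ κ t ∣ t + 1 ∧ 2 ^ κ (t+1) ∣ t + 1)
    (hs : ∀ t, 1 ≤ t → 4 ^ κ t ≤ t) (hκ : Tendsto κ atTop atTop)
    {u : ℕ × ℕ → X} {g : ℕ → X}
    {φ : X → ℝ} {C : ℝ} (h0 : ∀ x, 0 ≤ φ x) (hC : ∀ x, φ x ≤ C) {L : ℝ}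
    (h : Tendsto (fun j => avg (fun i => φ (u (j, i))) (2 ^ j)) atTop (𝓝 L)) :
    Tendsto (avg fun s => φ (Xp κ u g s)) atTop (𝓝 L) := by
  have hC0 : 0 ≤ C := (h0 (g 0)).trans (hC _)
  have hb := avg_per hj hs hκ (ψ := fun j i => φ (u (j, i))) (C := C)
    (fun _ _ => h0 _) (fun _ _ => hC _) h
  have hc := avg_per hj hs hκ (ψ := fun _ i => if i = 0 then C else 0) (C := C) (L := 0)
    (fun _ _ => by split_ifs <;> simp [hC0]) (fun _ _ => by split_ifs <;> simp [hC0]) (by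
      have h1 : ∀ j : ℕ, avg (fun i => if i = 0 then C else 0) (2 ^ j) = C * (1 / 2) ^ j := fun j => by
        unfold avg
        rw [Finset.sum_ite_eq' (Finset.range (2 ^ j)) 0 (fun _ => C),
          if_pos (Finset.mem_range.2 (by positivity))]
        push_cast
        rw [one_div, inv_pow]; rfl
      simp only [h1]
      simpa using (tendsto_pow_atTop_nhds_zero_of_lt_one (r := (1 / 2 : ℝ))
        (by norm_num) (by norm_num)).const_mul C)
  refine tendsto_of_tendsto_of_dist hb (squeeze_zero (fun _ => dist_nonneg) (fun t => ?_) hc)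
  rw [Real.dist_eq]
  unfold avg
  rw [← sub_div, abs_div, Nat.abs_cast, ← Finset.sum_sub_distrib]
  gcongr
  refine (Finset.abs_sum_le_sum_abs _ _).trans (Finset.sum_le_sum fun s _ => ?_)
  unfold Xp
  by_cases hd : 2 ^ κ s ∣ s
  · rw [if_pos hd, if_pos (Nat.mod_eq_zero_of_dvd hd), abs_le]
    have a1 := h0 (u (κ s, s % 2 ^ κ s)); have a2 := hC (u (κ s, s % 2 ^ κ s))
    have a3 := h0 (g s); have a4 := hC (g s)
    constructor <;> linarith
  · rw [if_neg hd, if_neg (fun h => hd (Nat.dvd_of_mod_eq_zero h))]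
    simp

section
variable {X Y : Type*} [MeasurableSpace X] [MetricSpace Y]
  [TopologicalSpace.SeparableSpace Y] [Nonempty Y] [MeasurableSpace Y] [BorelSpace Y]
  [MeasurableSpace.CountablyGenerated X]
  (π : Measure X) [IsProbabilityMeasure π]

lemma main_suil {C : ℝ} (hbdd : ∀ y₁ y₂ : Y, dist y₁ y₂ ≤ C) {κ : ℕ → ℕ} (g : ℕ → X)
    (hj : ∀ t, κ (t+1) ≠ κ t → 2 ^ κ t ∣ t + 1 ∧ 2 ^ κ (t+1) ∣ t + 1)
    (hs : ∀ t, 1 ≤ t → 4 ^ κ t ≤ t) (hκ : Tendsto κ atTop atTop)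
    (hT : ∀ m, ∃ T, 2 ^ (m + 1) ∣ T ∧ ∀ i < 2 ^ (m + 1), κ (T + i) = m + 1) :
    SUIL Y ((iid π (ℕ × ℕ)).map (fun u => Xp κ u g)) := by
  choose T hT1 hT2 using hT
  have hXm : Measurable (fun u : ℕ × ℕ → X => Xp κ u g) :=
    (measurable_Xp κ).comp measurable_prodMk_right
  have hx : ∀ u m, ∀ j < 2 ^ m, Xp κ u g (T m + (1 + j)) = u (m + 1, 1 + j) := fun u m j hj => by
    have hlt : 1 + j < 2 ^ (m + 1) := by rw [pow_succ]; omega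
    have h1 : ¬ 2 ^ (m + 1) ∣ T m + (1 + j) := fun hd => by
      have := (Nat.dvd_add_right (hT1 m)).1 hd
      exact absurd (Nat.le_of_dvd (by omega) this) (by omega)
    obtain ⟨c, hc⟩ := hT1 m
    have h2 : (T m + (1 + j)) % 2 ^ (m + 1) = 1 + j := by
      rw [hc, Nat.mul_add_mod, Nat.mod_eq_of_lt hlt]
    simp only [Xp, hT2 m _ hlt, h1, if_false, h2]
  refine suil_crit (C := C) _ π hbdd
    (fun m a => avg (fun j => a (T m + (1 + j))) (2 ^ m))
    (fun m => by unfold avg; fun_prop) (fun m => T m + 1 + 2 ^ m) ?_ (C ^ 2) (sq_nonneg _) ?_ ?_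
  · intro m a b hab
    unfold avg
    congr 1
    refine Finset.sum_congr rfl fun q hq => hab _ ?_
    have := Finset.mem_range.1 hq
    omega
  · intro φ hφ h0 hC m
    rw [lintegral_map _ hXm]
    · have : ∀ u : ℕ × ℕ → X, avg (fun j => φ (Xp κ u g (T m + (1 + j)))) (2 ^ m)
          = avg (fun j => φ (u (m + 1, 1 + j))) (2 ^ m) := fun u => by
        unfold avg
        congr 1
        exact Finset.sum_congr rfl fun q hq => congrArg φ (hx u m q (Finset.mem_range.1 hq))
      simp only [this]
      refine (iid_var π hφ h0 hC (e := fun j => (m + 1, 1 + j)) ?_ (M := 2 ^ m)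
        (by positivity)).trans (le_of_eq ?_)
      · intro a b hab
        have := (Prod.ext_iff.1 hab).2
        simp only at this
        omega
      · congr 1
        push_cast
        rw [one_div, inv_pow]; rfl
    · unfold avg; fun_prop
  · intro φ hφ h0 hC
    have hm : ∀ᵐ u ∂(iid π (ℕ × ℕ)), Tendsto (avg fun s => φ (Xp κ u g s)) atTop
        (𝓝 (∫ z, φ z ∂π)) := by
      filter_upwards [hist_tri π (F := fun _ x => φ x) (hφ.comp measurable_snd) (fun _ => h0)
        (fun _ => hC) ∅ (fun _ _ _ => rfl) (e := fun j i => ((j, i) : ℕ × ℕ))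
        (fun j => Prod.mk_right_injective j) (by simp)] with u hu
      exact main_det hj hs hκ h0 hC hu
    have hm2 : ∀ᵐ x ∂((iid π (ℕ × ℕ)).map (fun u => Xp κ u g)),
        Tendsto (avg fun s => φ (x s)) atTop (𝓝 (∫ z, φ z ∂π)) := by
      refine (ae_map_iff hXm.aemeasurable ?_).2 hm
      refine measurableSet_tendsto_fun (fun M => ?_) measurable_const
      unfold avg; fun_prop
    filter_upwards [hm2] with x hx
    exact ⟨_, le_rfl, hx⟩

variable [MeasurableSingletonClass X] {f : ∀ n : ℕ, (Fin n → X) → (Fin n → Y) → X → Y}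
  (hf : IsInductiveRule f)

include hf in
lemma final_contra [NullSingletonClass π] {C : ℝ} (hbdd : ∀ y₁ y₂ : Y, dist y₁ y₂ ≤ C)
    (hcons : ∀ μ : Measure (ℕ → X), IsProbabilityMeasure μ → SUIL Y μ → StronglyConsistentInd μ f)
    (y0 y1 : Y) (hd : 0 < dist y0 y1) : False := by
  classical
  set d := dist y0 y1 with hdd
  obtain ⟨κ, N, hmono, hκ, hj, hs, hT, hN, hB⟩ := schedule
    (Pr := fun κ k n => ((iid π (ℕ × ℕ)).prod (iid π ℕ)) {p | d / 2 < D π f y0 y1 κ n p}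
      ≤ (1 / 2) ^ k)
    (by
      intro κ κ' k n hkk h
      have : D π f y0 y1 κ n = D π f y0 y1 κ' n := by
        funext p
        have e1 : (fun i : Fin n => Xp κ p.1 p.2 i.1) = (fun i : Fin n => Xp κ' p.1 p.2 i.1) := by
          funext i; unfold Xp; rw [hkk i.1 i.2]
        have e2 : (fun i : Fin n => lab y0 y1 κ i.1) = (fun i : Fin n => lab y0 y1 κ' i.1) := by
          funext i; unfold lab; rw [hkk i.1 i.2]
        simp only [D, ls, e1, e2]
      rw [← this]; exact h)
    (fun κ k T h => D_step π hf hbdd hcons y0 y1 (half_pos hd) h)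
  have hae : ∀ᵐ p ∂((iid π (ℕ × ℕ)).prod (iid π ℕ)), ∀ᶠ k in atTop,
      p ∉ {p | d / 2 < D π f y0 y1 κ (N k) p} := by
    refine ae_eventually_notMem (ne_top_of_le_ne_top ?_ (ENNReal.tsum_le_tsum hB))
    rw [ENNReal.tsum_geometric]
    simp
  have hsw : ∀ᵐ q ∂((iid π ℕ).prod (iid π (ℕ × ℕ))), ∀ᶠ k in atTop,
      q.swap ∉ {p | d / 2 < D π f y0 y1 κ (N k) p} := by
    have h := Measure.prod_swap (μ := iid π ℕ) (ν := iid π (ℕ × ℕ))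
    rw [← h] at hae
    exact ae_of_ae_map measurable_swap.aemeasurable hae
  obtain ⟨g, hg⟩ := (Measure.ae_ae_of_ae_prod hsw).exists
  have hXm : Measurable (fun u : ℕ × ℕ → X => Xp κ u g) :=
    (measurable_Xp κ).comp measurable_prodMk_right
  have hc := hcons ((iid π (ℕ × ℕ)).map (fun u => Xp κ u g))
    (Measure.isProbabilityMeasure_map hXm.aemeasurable) (main_suil π hbdd g hj hs hκ hT)
  let fstar : X → Y := fun x => if x ∈ Set.range g then y1 else y0
  have hfs : Measurable fstar := Measurable.ite (Set.countable_range g).measurableSet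
    measurable_const measurable_const
  have h1 := ae_of_ae_map hXm.aemeasurable (hc fstar hfs)
  have hlm : ∀ y n, Measurable fun p : (ℕ × ℕ → X) × X => ls f y0 y1 y κ n (p.1, g) p.2 :=
    fun y n => by
      have hm : Measurable fun p : (ℕ × ℕ → X) × X =>
          (((p.1, g), p.2) : ((ℕ × ℕ → X) × (ℕ → X)) × X) :=
        (measurable_fst.prodMk measurable_const).prodMk measurable_snd
      exact (measurable_ls hf y0 y1 y κ n).comp hm
  have h2 : ∀ᵐ u ∂(iid π (ℕ × ℕ)), ∀ n, Tendsto
      (fun j => avg (fun q => ls f y0 y1 y0 κ n (u, g) (u (j, q))) (2 ^ j))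
      atTop (𝓝 (∫ x, ls f y0 y1 y0 κ n (u, g) x ∂π)) := by
    rw [ae_all_iff]
    intro n
    refine hist_tri π (F := fun u x => ls f y0 y1 y0 κ n (u, g) x) (hlm y0 n)
      (fun _ _ => dist_nonneg) (fun _ _ => hbdd _ _) {p | p.1 ≤ κ n} ?_
      (e := fun j i => ((j, i) : ℕ × ℕ)) (fun j => Prod.mk_right_injective j) ?_
    · intro a b hab
      funext x
      have : (fun i : Fin n => Xp κ a g i.1) = (fun i : Fin n => Xp κ b g i.1) := by
        funext i
        unfold Xp
        rw [hab (κ i.1, _) (hmono i.2.le)]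
      simp only [ls, this]
    · filter_upwards [eventually_gt_atTop (κ n)] with j hjn i
      change ¬ (j ≤ κ n)
      omega
  obtain ⟨u, g1, g2, g3, g4⟩ := (h1.and (h2.and
    ((iid_notMem (ι := ℕ × ℕ) π (Set.countable_range g)).and hg))).exists
  have hlab : ∀ s, fstar (Xp κ u g s) = lab y0 y1 κ s := fun s => by
    by_cases hd : 2 ^ κ s ∣ s
    · simp only [fstar, Xp, lab, if_pos hd, if_pos (Set.mem_range_self _)]
    · simp only [fstar, Xp, lab, if_neg hd, if_neg (g3 _)]
  have hge : ∀ n, d - D π f y0 y1 κ n (u, g) ≤ indLoss f fstar n (Xp κ u g) := fun n => by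
    let φ : X → ℝ := fun x =>
      dist (f n (fun i => Xp κ u g i.1) (fun i => lab y0 y1 κ i.1) x) (fstar x)
    have hφ : Tendsto (fun j => avg (fun q => φ (u (j, q))) (2 ^ j)) atTop
        (𝓝 (∫ x, ls f y0 y1 y0 κ n (u, g) x ∂π)) := by
      refine (g2 n).congr' (Eventually.of_forall fun t => ?_)
      congr 1
      funext q
      simp only [φ, ls, fstar, if_neg (g3 _)]
    have h3 := main_det (g := g) hj hs hκ (φ := φ) (C := C) (fun _ => dist_nonneg)
      (fun _ => hbdd _ _) hφ
    have h4 : indLoss f fstar n (Xp κ u g) = _ := indLoss_eq f fstar n (Xp κ u g) (L := _) (by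
      simp only [hlab]
      refine h3.congr' (Eventually.of_forall fun t => ?_)
      congr 1
      funext s
      simp only [φ, hlab])
    rw [h4, sub_le_iff_le_add, D]
    have hi : ∀ y, Integrable (fun x => ls f y0 y1 y κ n (u, g) x) π := fun y =>
      integrable_bdd ((hlm y n).comp measurable_prodMk_left) (C := C) (fun _ => dist_nonneg)
        (fun _ => hbdd _ _)
    rw [← integral_add (hi _) (hi _)]
    calc d = ∫ _, d ∂π := by simp
      _ ≤ _ := integral_mono (integrable_const _) ((hi _).add (hi _)) fun x => by
        simp only [ls, hdd]
        exact dist_triangle_left _ _ _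
  have hev : ∀ᶠ k in atTop, d / 2 ≤ indLoss f fstar (N k) (Xp κ u g) := by
    filter_upwards [g4] with k hk
    have h5 : D π f y0 y1 κ (N k) (u, g) ≤ d / 2 := not_lt.1 hk
    have := hge (N k)
    linarith
  have := ge_of_tendsto (g1.comp hN) hev
  linarith

end

lemma exists_nonatomic (X : Type*) [TopologicalSpace X] [PolishSpace X] [MeasurableSpace X]
    [BorelSpace X] [Uncountable X] :
    ∃ π : Measure X, IsProbabilityMeasure π ∧ NullSingletonClass π := by
  let e : ℝ ≃ᵐ X := PolishSpace.measurableEquivOfNotCountable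
    (by rw [not_countable_iff]; infer_instance) (by rw [not_countable_iff]; infer_instance)
  let v : Measure ℝ := volume.restrict (Set.Icc 0 1)
  have hv : IsProbabilityMeasure v := ⟨by simp [v]⟩
  refine ⟨v.map e, Measure.isProbabilityMeasure_map e.measurable.aemeasurable, ⟨fun x => ?_⟩⟩
  rw [e.map_apply]
  have : e ⁻¹' {x} = {e.symm x} := by
    ext z
    simp only [Set.mem_preimage, Set.mem_singleton_iff]
    exact e.toEquiv.apply_eq_iff_eq_symm_apply
  rw [this]
  simp

end NoOpt
/-- **Theorem 2 (Hanneke).** If `X` is an uncountable Polish space, there is no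
optimistically universal inductive learning rule: for every inductive learning rule there
is a process in `SUIL` under which it fails to be strongly universally consistent. -/
theorem no_optimistically_universal_inductive (X Y : Type*)
    [TopologicalSpace X] [PolishSpace X] [Nonempty X] [MeasurableSpace X] [BorelSpace X] [Uncountable X]
    [MetricSpace Y] [TopologicalSpace.SeparableSpace Y] [Nonempty Y]
    [MeasurableSpace Y] [BorelSpace Y]
    (hbdd : ∃ C : ℝ, ∀ y₁ y₂ : Y, dist y₁ y₂ ≤ C)
    (hnontriv : ∃ y₁ y₂ : Y, 0 < dist y₁ y₂) :
    ∀ f : ∀ n : ℕ, (Fin n → X) → (Fin n → Y) → X → Y, IsInductiveRule f →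
      ∃ μ : Measure (ℕ → X), IsProbabilityMeasure μ ∧ SUIL Y μ ∧
        ¬ StronglyConsistentInd μ f := by
  intro f hf
  by_contra hcon
  push Not at hcon
  obtain ⟨C, hC⟩ := hbdd
  obtain ⟨y0, y1, hd⟩ := hnontriv
  obtain ⟨π, hπ1, hπ2⟩ := NoOpt.exists_nonatomic X
  exact NoOpt.final_contra π hf hC (fun μ h1 h2 => hcon μ h1 h2) y0 y1 hd
end
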